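/- Let d ≥ 4 be an integer and let P ⊂ ℝ^d be a reflexive polytope. Then vol(P) ≤ 2(s_d − 1)^2 / d!, with equality if and only if P is unimodularly equivalent to R_(d). -/

import Mathlib

open MeasureTheory Set
open scoped ENNReal

/-- The Sylvester sequence, 0-indexed: `sylvester 0 = 2 = s₁`,
`sylvester (n+1) = (sylvester n)^2 - sylvester n + 1`, so that `sₙ = sylvester (n-1)`. -/
def sylvester : ℕ → ℕ
  | 0 => 2
  | n + 1 => (sylvester n) ^ 2 - sylvester n + 1

/-- A point of `ℝ^d` is a lattice point if all its coordinates are integers. -/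
def IsLatticePt {d : ℕ} (x : Fin d → ℝ) : Prop := ∀ i, ∃ z : ℤ, x i = (z : ℝ)

/-- A lattice polytope: the convex hull of finitely many lattice points. -/
def IsLatticePolytope {d : ℕ} (P : Set (Fin d → ℝ)) : Prop :=
  ∃ V : Finset (Fin d → ℝ), (∀ v ∈ V, IsLatticePt v) ∧ P = convexHull ℝ (V : Set (Fin d → ℝ))

/-- A canonical Fano polytope in `ℝ^d`: a lattice polytope (automatically of full
dimension `d`) whose interior contains exactly one lattice point, namely the origin. -/
def IsCanonicalFano {d : ℕ} (P : Set (Fin d → ℝ)) : Prop :=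
  IsLatticePolytope P ∧ {x ∈ interior P | IsLatticePt x} = {0}

/-- The dual (polar) of a set `P ⊆ ℝ^d`: all `y` with `⟨y, x⟩ ≥ -1` for every `x ∈ P`. -/
def polarDual {d : ℕ} (P : Set (Fin d → ℝ)) : Set (Fin d → ℝ) :=
  {y | ∀ x ∈ P, -1 ≤ ∑ i, y i * x i}

/-- The simplex `S_(d) = conv{0, s₁e₁, …, s_{d-1}e_{d-1}, 2(s_d - 1)e_d}`.
Coordinate `j` (0-indexed) of the basis corresponds to `e_{j+1}`, so the vertex on the
`j`-th axis is `s_{j+1}·e_{j+1}` for `j < d-1` and `2(s_d - 1)·e_d` for `j = d-1`. -/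
def Ssimplex (d : ℕ) : Set (Fin d → ℝ) :=
  convexHull ℝ ({0} ∪ {x : Fin d → ℝ | ∃ j : Fin d,
    x = (if (j : ℕ) = d - 1 then 2 * ((sylvester (d - 1) : ℝ) - 1) else (sylvester (j : ℕ) : ℝ))
      • (Pi.single j (1:ℝ) : Fin d → ℝ)})

/-- The simplex `R_(d) = S_(d) - (e₁ + ⋯ + e_d)`. -/
def Rsimplex (d : ℕ) : Set (Fin d → ℝ) := (fun x => x - fun _ => 1) '' Ssimplex d

/-- Unimodular equivalence: `Q = A·P + b` for some `A ∈ GL_d(ℤ)`, `b ∈ ℤ^d`. -/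
def UnimodularEquiv {d : ℕ} (P Q : Set (Fin d → ℝ)) : Prop :=
  ∃ (A : Matrix (Fin d) (Fin d) ℤ) (b : Fin d → ℤ), IsUnit A.det ∧
    Q = (fun x => (A.map (fun z : ℤ => (z : ℝ))).mulVec x + fun i => ((b i : ℤ) : ℝ)) '' P

/-- A reflexive polytope: a lattice polytope with `0` in its interior (hence of full
dimension `d`) whose dual is again a lattice polytope. -/
def IsReflexive {d : ℕ} (P : Set (Fin d → ℝ)) : Prop :=
  IsLatticePolytope P ∧ 0 ∈ interior P ∧ IsLatticePolytope (polarDual P)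

/-- The real number `s_{k+1} - 1`, where `s` is the Sylvester sequence. -/
noncomputable def sylvesterPred (k : ℕ) : ℝ := (sylvester k : ℝ) - 1

theorem sylvesterPred_zero : sylvesterPred 0 = 1 := by
  norm_num [sylvesterPred, sylvester]

theorem sylvesterPred_succ (k : ℕ) :
    sylvesterPred (k + 1) = sylvesterPred k * (sylvesterPred k + 1) := by
  have h : sylvester k ≤ sylvester k ^ 2 := Nat.le_self_pow two_ne_zero _
  simp only [sylvesterPred, sylvester]
  push_cast [h]
  ring

theorem one_le_sylvesterPred (k : ℕ) : 1 ≤ sylvesterPred k := by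
  induction k with
  | zero => exact sylvesterPred_zero.ge
  | succ k ih => rw [sylvesterPred_succ]; nlinarith

theorem sylvesterPred_pos (k : ℕ) : 0 < sylvesterPred k :=
  one_pos.trans_le (one_le_sylvesterPred k)

theorem sylvesterPred_mono : Monotone sylvesterPred :=
  monotone_nat_of_le_succ fun k => by
    rw [sylvesterPred_succ]; nlinarith [one_le_sylvesterPred k]

theorem sylvesterPred_one : sylvesterPred 1 = 2 := by
  rw [sylvesterPred_succ, sylvesterPred_zero]; norm_num

theorem sylvesterPred_two : sylvesterPred 2 = 6 := by
  rw [sylvesterPred_succ, sylvesterPred_one]; norm_num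

theorem sylvesterPred_three : sylvesterPred 3 = 42 := by
  rw [sylvesterPred_succ, sylvesterPred_two]; norm_num

theorem sum_inv_sylvesterPred_add_one (n : ℕ) :
    ∑ i ∈ Finset.range n, (sylvesterPred i + 1)⁻¹ = 1 - (sylvesterPred n)⁻¹ := by
  induction n with
  | zero => simp [sylvesterPred_zero]
  | succ n ih =>
    have h := sylvesterPred_pos n
    rw [Finset.sum_range_succ, ih, sylvesterPred_succ]
    field_simp
    ring

theorem prod_inv_sylvesterPred_add_one (n : ℕ) :
    ∏ i ∈ Finset.range n, (sylvesterPred i + 1)⁻¹ = (sylvesterPred n)⁻¹ := by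
  induction n with
  | zero => simp [sylvesterPred_zero]
  | succ n ih =>
    rw [Finset.prod_range_succ, ih, sylvesterPred_succ, mul_inv]

/-- Abel summation estimate: if all the proper partial sums of `δ` are nonnegative and `g` is
nondecreasing, then `∑ δ i * g i` is at most the total sum times the last value of `g`. -/
theorem sum_mul_le_sum_mul_last (δ g : ℕ → ℝ) (n : ℕ)
    (hg : ∀ i < n, g i ≤ g (i + 1))
    (hδ : ∀ j ≤ n, 0 ≤ ∑ i ∈ Finset.range j, δ i) :
    ∑ i ∈ Finset.range (n + 1), δ i * g i ≤ (∑ i ∈ Finset.range (n + 1), δ i) * g n := by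
  induction n with
  | zero => simp
  | succ n ih =>
    have h := ih (fun i hi => hg i (by omega)) (fun j hj => hδ j (by omega))
    have h2 := mul_le_mul_of_nonneg_left (hg n (by omega)) (hδ (n + 1) le_rfl)
    rw [Finset.sum_range_succ, Finset.sum_range_succ δ (n + 1), add_mul]
    linarith

/-- A form of the inequality of arithmetic and geometric means. -/
theorem prod_le_prod_of_sum_div_nonpos {ι : Type*} (s : Finset ι) (w x : ι → ℝ)
    (hw : ∀ i ∈ s, 0 < w i) (hx : ∀ i ∈ s, 0 < x i)
    (h : ∑ i ∈ s, (w i - x i) / x i ≤ 0) :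
    ∏ i ∈ s, w i ≤ ∏ i ∈ s, x i ∧
      (∏ i ∈ s, w i = ∏ i ∈ s, x i → ∀ i ∈ s, w i = x i) := by
  have hxp : 0 < ∏ i ∈ s, x i := Finset.prod_pos hx
  have hle : ∀ i ∈ s, w i / x i ≤ Real.exp ((w i - x i) / x i) := fun i hi => by
    have := Real.add_one_le_exp ((w i - x i) / x i)
    have h2 : (w i - x i) / x i + 1 = w i / x i := by
      have := (hx i hi).ne'
      field_simp
      ring
    linarith
  have hexp : ∏ i ∈ s, Real.exp ((w i - x i) / x i) ≤ 1 := by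
    rw [← Real.exp_sum]
    exact Real.exp_le_one_iff.2 h
  have hdiv : ∀ i ∈ s, 0 < w i / x i := fun i hi => div_pos (hw i hi) (hx i hi)
  constructor
  · have h1 := (Finset.prod_le_prod (fun i hi => (hdiv i hi).le) hle).trans hexp
    rw [Finset.prod_div_distrib, div_le_one hxp] at h1
    exact h1
  · intro heq
    by_contra! hne
    obtain ⟨k, hk, hkne⟩ := hne
    have hlt : w k / x k < Real.exp ((w k - x k) / x k) := by
      have h0 := (hx k hk).ne'
      have h1 : (w k - x k) / x k ≠ 0 := div_ne_zero (sub_ne_zero.2 hkne) h0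
      have := Real.add_one_lt_exp h1
      have h2 : (w k - x k) / x k + 1 = w k / x k := by
        field_simp
        ring
      linarith
    have h1 := (Finset.prod_lt_prod hdiv hle ⟨k, hk, hlt⟩).trans_le hexp
    rw [Finset.prod_div_distrib, heq, div_self hxp.ne'] at h1
    exact h1.false

/-- The sum of `n` nonincreasing positive numbers satisfying the product-sum inequalities is
largest for the reciprocals of the Sylvester sequence. -/
theorem sum_le_one_sub_inv_sylvesterPred (x : ℕ → ℝ) (n : ℕ)
    (hpos : ∀ i < n, 0 < x i) (hanti : ∀ i, i + 1 < n → x (i + 1) ≤ x i)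
    (hps : ∀ j ≤ n, ∏ i ∈ Finset.range j, x i ≤ 1 - ∑ i ∈ Finset.range j, x i) :
    ∑ i ∈ Finset.range n, x i ≤ 1 - (sylvesterPred n)⁻¹ := by
  induction n using Nat.strong_induction_on with
  | _ n ih =>
    rcases n with _ | n
    · simp [sylvesterPred_zero]
    by_contra! hlt
    set y : ℕ → ℝ := fun i => (sylvesterPred i + 1)⁻¹ with hy
    have hsum : ∀ j, ∑ i ∈ Finset.range j, (y i - x i)
        = 1 - (sylvesterPred j)⁻¹ - ∑ i ∈ Finset.range j, x i := fun j => by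
      rw [Finset.sum_sub_distrib, sum_inv_sylvesterPred_add_one]
    have habel := sum_mul_le_sum_mul_last (fun i => y i - x i) (fun i => (x i)⁻¹) n
      (fun i hi => inv_anti₀ (hpos _ (by omega)) (hanti i (by omega)))
      (fun j hj => by
        rw [hsum, sub_nonneg]
        exact ih j (by omega) (fun i hi => hpos i (by omega)) (fun i hi => hanti i (by omega))
          (fun k hk => hps k (by omega)))
    have hneg : ∑ i ∈ Finset.range (n + 1), (y i - x i) / x i < 0 := by
      simp only [div_eq_mul_inv]
      refine habel.trans_lt (mul_neg_of_neg_of_pos ?_ (inv_pos.2 (hpos n (by omega))))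
      rw [hsum]
      linarith
    have hypos : ∀ i ∈ Finset.range (n + 1), 0 < y i := fun i _ => by
      have := sylvesterPred_pos i
      positivity
    obtain ⟨h1, h2⟩ := prod_le_prod_of_sum_div_nonpos (Finset.range (n + 1)) y x hypos
      (fun i hi => hpos i (Finset.mem_range.1 hi)) hneg.le
    have h3 := hps (n + 1) le_rfl
    rw [prod_inv_sylvesterPred_add_one] at h1
    linarith

/-- The sequence that starts with `l` reciprocals of the Sylvester sequence and continues with
constant terms such that the sum of the first `n + 2` terms is one. -/
noncomputable def sylvesterWeight (n l i : ℕ) : ℝ :=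
  if i < l then (sylvesterPred i + 1)⁻¹ else (((n : ℝ) + 2 - l) * sylvesterPred l)⁻¹

theorem sylvesterWeight_pos {n l : ℕ} (hl : l ≤ n) (i : ℕ) : 0 < sylvesterWeight n l i := by
  have h1 := sylvesterPred_pos i
  have h2 := sylvesterPred_pos l
  have h3 : (0 : ℝ) < n + 2 - l := by
    have : (l : ℝ) ≤ n := by exact_mod_cast hl
    linarith
  unfold sylvesterWeight
  split_ifs <;> positivity

theorem sum_sylvesterWeight_of_le {n l j : ℕ} (hj : j ≤ l) :
    ∑ i ∈ Finset.range j, sylvesterWeight n l i = 1 - (sylvesterPred j)⁻¹ := by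
  rw [← sum_inv_sylvesterPred_add_one]
  refine Finset.sum_congr rfl fun i hi => ?_
  rw [sylvesterWeight, if_pos (by have := Finset.mem_range.1 hi; omega)]

theorem sum_sylvesterWeight_of_ge {n l j : ℕ} (hl : l ≤ n) (hj : l ≤ j) :
    ∑ i ∈ Finset.range j, sylvesterWeight n l i
      = 1 - ((n : ℝ) + 2 - j) * (((n : ℝ) + 2 - l) * sylvesterPred l)⁻¹ := by
  have h3 : (0 : ℝ) < n + 2 - l := by
    have : (l : ℝ) ≤ n := by exact_mod_cast hl
    linarith
  have h2 := sylvesterPred_pos l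
  induction j, hj using Nat.le_induction with
  | base =>
    rw [sum_sylvesterWeight_of_le le_rfl]
    field_simp
  | succ j hj ih =>
    rw [Finset.sum_range_succ, ih, sylvesterWeight, if_neg (by omega)]
    push_cast
    ring

theorem prod_sylvesterWeight {n l : ℕ} (hl : l ≤ n) :
    ∏ i ∈ Finset.range (n + 1), sylvesterWeight n l i
      = (sylvesterPred l * (((n : ℝ) + 2 - l) * sylvesterPred l) ^ (n + 1 - l))⁻¹ := by
  obtain ⟨e, rfl⟩ := Nat.exists_eq_add_of_le hl
  have h1 : ∏ i ∈ Finset.range l, sylvesterWeight (l + e) l i = (sylvesterPred l)⁻¹ := by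
    rw [← prod_inv_sylvesterPred_add_one l]
    refine Finset.prod_congr rfl fun i hi => ?_
    rw [sylvesterWeight, if_pos (Finset.mem_range.1 hi)]
  have h2 : ∏ i ∈ Finset.range (e + 1), sylvesterWeight (l + e) l (l + i)
      = ((((l + e : ℕ) : ℝ) + 2 - l) * sylvesterPred l)⁻¹ ^ (e + 1) := by
    rw [Finset.prod_congr rfl fun i _ => by rw [sylvesterWeight, if_neg (by omega)],
      Finset.prod_const, Finset.card_range]
  rw [add_assoc, Finset.prod_range_add, h1, h2, inv_pow, ← mul_inv,
    show l + (e + 1) - l = e + 1 by omega]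

/-- The last two weights have a sum that is at least `1 / (s_{n+1} - 1)`. -/
theorem inv_two_mul_sylvesterPred_le (x : ℕ → ℝ) (n : ℕ)
    (hpos : ∀ i ≤ n + 1, 0 < x i) (hanti : ∀ i ≤ n, x (i + 1) ≤ x i)
    (hsum : ∑ i ∈ Finset.range (n + 2), x i = 1)
    (hps : ∀ j ≤ n + 1, ∏ i ∈ Finset.range j, x i ≤ 1 - ∑ i ∈ Finset.range j, x i) :
    (2 * sylvesterPred n)⁻¹ ≤ (x n + x (n + 1)) / 2 := by
  have h := sum_le_one_sub_inv_sylvesterPred x n (fun i hi => hpos i (by omega))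
    (fun i hi => hanti i (by omega)) (fun j hj => hps j (by omega))
  rw [Finset.sum_range_succ, Finset.sum_range_succ] at hsum
  rw [mul_inv]
  linarith

/-- The product of all the weights but the smallest one is at least the corresponding product for
one of the sequences `sylvesterWeight n l`. -/
theorem exists_prod_sylvesterWeight_le (x : ℕ → ℝ) (n : ℕ)
    (hpos : ∀ i ≤ n + 1, 0 < x i) (hanti : ∀ i ≤ n, x (i + 1) ≤ x i)
    (hsum : ∑ i ∈ Finset.range (n + 2), x i = 1)
    (hps : ∀ j ≤ n + 1, ∏ i ∈ Finset.range j, x i ≤ 1 - ∑ i ∈ Finset.range j, x i) :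
    ∃ l ≤ n, ∏ i ∈ Finset.range (n + 1), sylvesterWeight n l i
        ≤ ∏ i ∈ Finset.range (n + 1), x i ∧
      (∏ i ∈ Finset.range (n + 1), sylvesterWeight n l i = ∏ i ∈ Finset.range (n + 1), x i →
        ∀ i ≤ n, sylvesterWeight n l i = x i) := by
  set t := (x n + x (n + 1)) / 2 with ht
  have htn : t ≤ x n := by have := hanti n le_rfl; linarith
  have htpos : 0 < t := by
    have h1 := hpos n (by omega)
    have h2 := hpos (n + 1) le_rfl
    linarith
  have hXn : ∑ i ∈ Finset.range n, x i = 1 - 2 * t := by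
    rw [Finset.sum_range_succ, Finset.sum_range_succ] at hsum
    linarith
  set x' : ℕ → ℝ := fun i => if i < n then x i else t with hx'
  have hx'n : x' n = t := by simp [hx']
  have hx'lt : ∀ i < n, x' i = x i := fun i hi => by simp [hx', hi]
  have hxanti : ∀ i ≤ n, x n ≤ x i := fun i hi => by
    induction hi using Nat.decreasingInduction with
    | self => exact le_rfl
    | of_succ k hk ih => exact ih.trans (hanti k hk.le)
  have htx' : ∀ i ≤ n, t ≤ x' i := fun i hi => by
    rcases hi.lt_or_eq with h | rfl
    · rw [hx'lt i h]; exact htn.trans (hxanti i hi)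
    · exact hx'n.ge
  have hx'pos : ∀ i ≤ n, 0 < x' i := fun i hi => htpos.trans_le (htx' i hi)
  have hx'anti : ∀ i < n, x' (i + 1) ≤ x' i := fun i hi => by
    rcases Nat.lt_or_ge (i + 1) n with h | h
    · rw [hx'lt i hi, hx'lt _ h]; exact hanti i (by omega)
    · obtain rfl : i + 1 = n := by omega
      rw [hx'n]; exact htx' i (by omega)
  have hsumx' : ∀ j ≤ n, ∑ i ∈ Finset.range j, x' i = ∑ i ∈ Finset.range j, x i := fun j hj =>
    Finset.sum_congr rfl fun i hi => hx'lt i (by have := Finset.mem_range.1 hi; omega)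
  have hsumx'n : ∑ i ∈ Finset.range (n + 1), x' i = 1 - t := by
    rw [Finset.sum_range_succ, hsumx' n le_rfl, hXn, hx'n]; ring
  have hsum_le : ∀ j ≤ n + 1, ∑ i ∈ Finset.range j, x' i ≤ 1 - ((n : ℝ) + 2 - j) * t :=
    fun j hj => by
    induction hj using Nat.decreasingInduction with
    | self => rw [hsumx'n]; push_cast; linarith
    | of_succ k hk ih =>
      rw [Finset.sum_range_succ] at ih
      have := htx' k (by omega)
      push_cast at ih
      linarith
  suffices h : ∃ l ≤ n,
      ∑ i ∈ Finset.range (n + 1), (sylvesterWeight n l i - x' i) / x' i ≤ 0 by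
    obtain ⟨l, hl, hle⟩ := h
    obtain ⟨h1, h2⟩ := prod_le_prod_of_sum_div_nonpos (Finset.range (n + 1))
      (sylvesterWeight n l) x' (fun i _ => sylvesterWeight_pos hl i)
      (fun i hi => hx'pos i (by have := Finset.mem_range.1 hi; omega)) hle
    have hprod : ∏ i ∈ Finset.range n, x' i = ∏ i ∈ Finset.range n, x i :=
      Finset.prod_congr rfl fun i hi => hx'lt i (Finset.mem_range.1 hi)
    have hprodpos : 0 < ∏ i ∈ Finset.range n, x i :=
      Finset.prod_pos fun i hi => hpos i (by have := Finset.mem_range.1 hi; omega)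
    have h3 : ∏ i ∈ Finset.range (n + 1), x' i ≤ ∏ i ∈ Finset.range (n + 1), x i := by
      rw [Finset.prod_range_succ, Finset.prod_range_succ, hprod, hx'n]
      exact mul_le_mul_of_nonneg_left htn hprodpos.le
    refine ⟨l, hl, h1.trans h3, fun heq i hi => ?_⟩
    have h4 := h2 (le_antisymm h1 (h3.trans heq.ge)) i (Finset.mem_range.2 (by omega))
    rw [h4]
    rcases hi.lt_or_eq with h | rfl
    · exact hx'lt i h
    · have h5 : ∏ i ∈ Finset.range (i + 1), x' i = ∏ i ∈ Finset.range (i + 1), x i :=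
        le_antisymm h3 (heq.ge.trans h1)
      rw [Finset.prod_range_succ, Finset.prod_range_succ, hprod] at h5
      exact mul_left_cancel₀ hprodpos.ne' h5
  set τ : ℕ → ℝ := fun l => (((n : ℝ) + 2 - l) * sylvesterPred l)⁻¹ with hτ
  have hτn : τ n ≤ t := by
    have := inv_two_mul_sylvesterPred_le x n hpos hanti hsum hps
    simpa [hτ] using this
  classical
  have hex : ∃ l, τ l ≤ t := ⟨n, hτn⟩
  obtain ⟨l, hlt, hlmin⟩ : ∃ l, τ l ≤ t ∧ ∀ k < l, t < τ k :=
    ⟨Nat.find hex, Nat.find_spec hex, fun k hk => not_le.1 (Nat.find_min hex hk)⟩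
  have hln : l ≤ n := by
    by_contra! h
    exact (hlmin n h).not_ge hτn
  rcases l with _ | k
  · refine ⟨0, hln, Finset.sum_nonpos fun i hi => ?_⟩
    have hi' : i ≤ n := by have := Finset.mem_range.1 hi; omega
    refine div_nonpos_of_nonpos_of_nonneg ?_ (hx'pos i hi').le
    have : sylvesterWeight n 0 i = τ 0 := by simp [sylvesterWeight, hτ]
    rw [this, sub_nonpos]
    exact hlt.trans (htx' i hi')
  · have hk := hlmin k (by omega)
    obtain ⟨c, hc0, hc1, hc⟩ : ∃ c : ℝ, 0 ≤ c ∧ c ≤ 1 ∧ t = c * τ k + (1 - c) * τ (k + 1) := by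
      have hd : 0 < τ k - τ (k + 1) := by linarith
      refine ⟨(t - τ (k + 1)) / (τ k - τ (k + 1)), div_nonneg (by linarith) hd.le,
        (div_le_one hd).2 (by linarith), ?_⟩
      field_simp
      ring
    set z : ℕ → ℝ := fun i =>
      c * (sylvesterWeight n k i - x' i) + (1 - c) * (sylvesterWeight n (k + 1) i - x' i) with hz
    have hzsum : ∀ j, ∑ i ∈ Finset.range j, z i
        = c * ∑ i ∈ Finset.range j, sylvesterWeight n k i
          + (1 - c) * ∑ i ∈ Finset.range j, sylvesterWeight n (k + 1) i
          - ∑ i ∈ Finset.range j, x' i := fun j => by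
      simp only [hz, Finset.sum_add_distrib, ← Finset.mul_sum, Finset.sum_sub_distrib]
      ring
    have hzge : ∀ j, k + 1 ≤ j → ∑ i ∈ Finset.range j, z i
        = 1 - ((n : ℝ) + 2 - j) * t - ∑ i ∈ Finset.range j, x' i := fun j hj => by
      rw [hzsum, sum_sylvesterWeight_of_ge (by omega) (by omega),
        sum_sylvesterWeight_of_ge (by omega) (by omega), hc]
      ring
    have habel := sum_mul_le_sum_mul_last z (fun i => (x' i)⁻¹) n
      (fun i hi => inv_anti₀ (hx'pos _ (by omega)) (hx'anti i hi))
      (fun j hj => by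
        rcases Nat.lt_or_ge k j with h | h
        · rw [hzge j h, sub_nonneg]
          exact hsum_le j (by omega)
        · rw [hzsum, sum_sylvesterWeight_of_le h, sum_sylvesterWeight_of_le (by omega),
            hsumx' j hj]
          have := sum_le_one_sub_inv_sylvesterPred x j (fun i hi => hpos i (by omega))
            (fun i hi => hanti i (by omega)) (fun j hj => hps j (by omega))
          linarith)
    rw [hzge (n + 1) (by omega), hsumx'n] at habel
    have hnonpos : c * ∑ i ∈ Finset.range (n + 1), (sylvesterWeight n k i - x' i) / x' i
        + (1 - c) * ∑ i ∈ Finset.range (n + 1), (sylvesterWeight n (k + 1) i - x' i) / x' i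
        ≤ 0 := by
      rw [Finset.mul_sum, Finset.mul_sum, ← Finset.sum_add_distrib]
      refine le_trans (le_of_eq ?_) (habel.trans (le_of_eq ?_))
      · refine Finset.sum_congr rfl fun i _ => ?_
        simp only [hz, div_eq_mul_inv]
        ring
      · push_cast
        ring
    by_contra! hcon
    have h1 := hcon k (by omega)
    have h2 := hcon (k + 1) hln
    rcases hc0.eq_or_lt with rfl | h
    · linarith
    · nlinarith [mul_pos h h1, mul_nonneg (sub_nonneg.2 hc1) h2.le]

theorem succ_pow_le_three_mul_pow (e : ℕ) : ((e : ℝ) + 1) ^ e ≤ 3 * (e : ℝ) ^ e := by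
  rcases Nat.eq_zero_or_pos e with rfl | he
  · norm_num
  have he' : (0 : ℝ) < e := by exact_mod_cast he
  have h1 : ((e : ℝ)⁻¹ + 1) ^ e ≤ 3 := by
    calc ((e : ℝ)⁻¹ + 1) ^ e ≤ Real.exp ((e : ℝ)⁻¹) ^ e := by
          gcongr
          exact Real.add_one_le_exp _
      _ = Real.exp 1 := by rw [← Real.exp_nat_mul, mul_inv_cancel₀ he'.ne']
      _ ≤ 3 := Real.exp_one_lt_three.le
  calc ((e : ℝ) + 1) ^ e = ((e : ℝ)⁻¹ + 1) ^ e * (e : ℝ) ^ e := by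
        rw [← mul_pow]; congr 1; field_simp; ring
    _ ≤ 3 * (e : ℝ) ^ e := by gcongr

theorem three_mul_le_add_one_pow {e : ℕ} {v : ℝ} (hv : 1 ≤ v)
    (h : 4 ≤ e ∨ e = 3 ∧ 2 ≤ v ∨ e = 2 ∧ 6 ≤ v) : 3 * e * v < (v + 1) ^ e := by
  rcases h with h | ⟨rfl, h⟩ | ⟨rfl, h⟩
  · induction e, h using Nat.le_induction with
    | base =>
      push_cast
      have hw := sub_nonneg.2 hv
      nlinarith [pow_nonneg hw 2, pow_nonneg hw 3, pow_nonneg hw 4]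
    | succ e he ih =>
      have he' : (4 : ℝ) ≤ e := by exact_mod_cast he
      rw [pow_succ]
      push_cast
      nlinarith [mul_nonneg (sub_nonneg.2 he') (sub_nonneg.2 hv)]
  · push_cast
    nlinarith [mul_nonneg (sub_nonneg.2 h) (sub_nonneg.2 hv), pow_nonneg (sub_nonneg.2 h) 3,
      pow_nonneg (sub_nonneg.2 h) 2]
  · push_cast
    nlinarith

theorem sylvester_prod_step {n l : ℕ} (hn : 3 ≤ n) (hl : l < n) :
    sylvesterPred l * (((n : ℝ) + 2 - l) * sylvesterPred l) ^ (n + 1 - l)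
      < sylvesterPred (l + 1) *
        (((n : ℝ) + 2 - (l + 1 : ℕ)) * sylvesterPred (l + 1)) ^ (n + 1 - (l + 1)) := by
  obtain ⟨f, rfl⟩ : ∃ f, n = l + 1 + f := Nat.exists_eq_add_of_le hl
  set v := sylvesterPred l with hv
  have hv1 : 1 ≤ v := one_le_sylvesterPred l
  have hv0 : 0 < v := one_pos.trans_le hv1
  have hkey : 3 * ((f + 2 : ℕ) : ℝ) * v < (v + 1) ^ (f + 2) := by
    refine three_mul_le_add_one_pow hv1 ?_
    rcases Nat.lt_or_ge l 2 with h | h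
    · rcases Nat.lt_or_ge l 1 with h' | h'
      · left; omega
      · rcases Nat.lt_or_ge f 2 with hf | hf
        · right; left
          refine ⟨by omega, ?_⟩
          rw [← sylvesterPred_one]
          exact sylvesterPred_mono h'
        · left; omega
    · have h6 : 6 ≤ v := by
        rw [← sylvesterPred_two]
        exact sylvesterPred_mono h
      rcases Nat.lt_or_ge f 2 with hf | hf
      · right
        rcases Nat.lt_or_ge f 1 with hf' | hf'
        · right; exact ⟨by omega, h6⟩
        · left; exact ⟨by omega, by linarith⟩
      · left; omega
  have h3 := succ_pow_le_three_mul_pow (f + 2)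
  rw [sylvesterPred_succ, ← hv, show l + 1 + f + 1 - l = f + 2 by omega,
    show l + 1 + f + 1 - (l + 1) = f + 1 by omega]
  push_cast at h3 hkey ⊢
  have e1 : (l : ℝ) + 1 + f + 2 - l = f + 2 + 1 := by ring
  have e2 : (l : ℝ) + 1 + f + 2 - (l + 1) = f + 2 := by ring
  rw [e1, e2]
  calc v * (((f : ℝ) + 2 + 1) * v) ^ (f + 2)
      = ((f : ℝ) + 2 + 1) ^ (f + 2) * (v * v ^ (f + 2)) := by rw [mul_pow]; ring
    _ ≤ 3 * ((f : ℝ) + 2) ^ (f + 2) * (v * v ^ (f + 2)) := by gcongr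
    _ = ((f : ℝ) + 2) ^ (f + 1) * v ^ (f + 2) * (3 * ((f : ℝ) + 2) * v) := by ring
    _ < ((f : ℝ) + 2) ^ (f + 1) * v ^ (f + 2) * (v + 1) ^ (f + 2) := by gcongr
    _ = v * (v + 1) * (((f : ℝ) + 2) * (v * (v + 1))) ^ (f + 1) := by
      rw [mul_pow, mul_pow]; ring

theorem sylvester_prod_lt {n l : ℕ} (hn : 3 ≤ n) (hl : l < n) :
    sylvesterPred l * (((n : ℝ) + 2 - l) * sylvesterPred l) ^ (n + 1 - l)
      < 2 * sylvesterPred n ^ 2 := by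
  have hend : sylvesterPred n * (((n : ℝ) + 2 - n) * sylvesterPred n) ^ (n + 1 - n)
      = 2 * sylvesterPred n ^ 2 := by
    rw [show n + 1 - n = 1 by omega]; ring
  rw [← hend]
  obtain ⟨k, hk⟩ := Nat.exists_eq_add_of_lt hl
  induction k generalizing l with
  | zero =>
    obtain rfl : n = l + 1 := by omega
    exact sylvester_prod_step hn hl
  | succ k ih => exact (sylvester_prod_step hn hl).trans (ih (by omega) (by omega))

/-- The reciprocal of a lower bound for the product of the `n + 1` largest weights of a lattice
simplex of dimension `n + 1` with a single interior lattice point. -/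
noncomputable def weightBound (n : ℕ) : ℝ :=
  if n = 0 then 2 else if n = 1 then 9 else 2 * sylvesterPred n ^ 2

theorem weightBound_of_two_le {n : ℕ} (hn : 2 ≤ n) : weightBound n = 2 * sylvesterPred n ^ 2 := by
  rw [weightBound, if_neg (by omega), if_neg (by omega)]

theorem weightBound_pos (n : ℕ) : 0 < weightBound n := by
  have := sylvesterPred_pos n
  unfold weightBound
  split_ifs <;> positivity

theorem sylvester_prod_le_weightBound {n l : ℕ} (hl : l ≤ n) :
    sylvesterPred l * (((n : ℝ) + 2 - l) * sylvesterPred l) ^ (n + 1 - l) ≤ weightBound n := by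
  rcases Nat.lt_or_ge n 3 with hn | hn
  · interval_cases n <;> interval_cases l <;>
      norm_num [weightBound, sylvesterPred_zero, sylvesterPred_one, sylvesterPred_two]
  · rw [weightBound_of_two_le (by omega)]
    rcases hl.lt_or_eq with h | rfl
    · exact (sylvester_prod_lt hn h).le
    · rw [show l + 1 - l = 1 by omega]
      exact le_of_eq (by ring)

theorem inv_weightBound_le_prod (x : ℕ → ℝ) (n : ℕ)
    (hpos : ∀ i ≤ n + 1, 0 < x i) (hanti : ∀ i ≤ n, x (i + 1) ≤ x i)
    (hsum : ∑ i ∈ Finset.range (n + 2), x i = 1)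
    (hps : ∀ j ≤ n + 1, ∏ i ∈ Finset.range j, x i ≤ 1 - ∑ i ∈ Finset.range j, x i) :
    (weightBound n)⁻¹ ≤ ∏ i ∈ Finset.range (n + 1), x i := by
  obtain ⟨l, hl, h, -⟩ := exists_prod_sylvesterWeight_le x n hpos hanti hsum hps
  refine le_trans ?_ h
  rw [prod_sylvesterWeight hl]
  refine inv_anti₀ ?_ (sylvester_prod_le_weightBound hl)
  have h1 := sylvesterPred_pos l
  have h2 : (l : ℝ) ≤ n := by exact_mod_cast hl
  have h3 : (0 : ℝ) < n + 2 - l := by linarith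
  positivity

theorem eq_sylvesterWeight_of_prod_eq (x : ℕ → ℝ) (n : ℕ) (hn : 3 ≤ n)
    (hpos : ∀ i ≤ n + 1, 0 < x i) (hanti : ∀ i ≤ n, x (i + 1) ≤ x i)
    (hsum : ∑ i ∈ Finset.range (n + 2), x i = 1)
    (hps : ∀ j ≤ n + 1, ∏ i ∈ Finset.range j, x i ≤ 1 - ∑ i ∈ Finset.range j, x i)
    (heq : ∏ i ∈ Finset.range (n + 1), x i = (weightBound n)⁻¹) :
    ∀ i ≤ n, x i = sylvesterWeight n n i := by
  obtain ⟨l, hl, h, h'⟩ := exists_prod_sylvesterWeight_le x n hpos hanti hsum hps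
  have hb := weightBound_of_two_le (show 2 ≤ n by omega)
  rcases hl.lt_or_eq with hlt | rfl
  · exfalso
    rw [prod_sylvesterWeight hl, heq, hb] at h
    have h1 := sylvesterPred_pos n
    have h2 := sylvester_prod_lt hn hlt
    have h3 := sylvesterPred_pos l
    have h4 : (l : ℝ) ≤ n := by exact_mod_cast hl
    have h5 : (0 : ℝ) < n + 2 - l := by linarith
    exact h.not_gt (inv_strictAnti₀ (by positivity) h2)
  · intro i hi
    refine (h' ?_ i hi).symm
    rw [prod_sylvesterWeight le_rfl, heq, hb, show l + 1 - l = 1 by omega]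
    congr 1
    ring

theorem weightBound_mul_pow_lt {N n : ℕ} (hN : 3 ≤ N) (hn : n < N) :
    weightBound n / (n + 1).factorial * (2 * sylvesterPred n) ^ (N - n)
      < 2 * sylvesterPred N ^ 2 / (N + 1).factorial := by
  have step : ∀ k, 2 ≤ k → 2 * sylvesterPred k ^ 2 / (k + 1).factorial * (2 * sylvesterPred k)
      < 2 * sylvesterPred (k + 1) ^ 2 / (k + 2).factorial := fun k hk => by
    have hk1 := sylvesterPred_pos k
    rw [Nat.factorial_succ (k + 1), div_mul_eq_mul_div, div_lt_div_iff₀ (by positivity)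
      (by positivity), sylvesterPred_succ]
    have hf : (0 : ℝ) < (k + 1).factorial := by positivity
    have hlin : 2 * ((k : ℝ) + 2) * sylvesterPred k < (sylvesterPred k + 1) ^ 2 := by
      rcases hk.lt_or_eq with h | rfl
      · have : ∀ j : ℕ, 3 ≤ j → 2 * ((j : ℝ) + 2) ≤ sylvesterPred j := fun j hj => by
          induction j, hj using Nat.le_induction with
          | base => rw [sylvesterPred_three]; norm_num
          | succ j hj ih =>
            have : (3 : ℝ) ≤ j := by exact_mod_cast hj
            rw [sylvesterPred_succ]
            push_cast
            nlinarith
        nlinarith [this k h]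
      · rw [sylvesterPred_two]; norm_num
    push_cast
    have e : 2 * (sylvesterPred k * (sylvesterPred k + 1)) ^ 2 * ((k + 1).factorial : ℝ)
        - 2 * sylvesterPred k ^ 2 * (2 * sylvesterPred k) * (((k : ℝ) + 1 + 1) *
          ((k + 1).factorial : ℝ))
        = 2 * sylvesterPred k ^ 2 * ((k + 1).factorial : ℝ)
          * ((sylvesterPred k + 1) ^ 2 - 2 * ((k : ℝ) + 2) * sylvesterPred k) := by ring
    rw [← sub_pos, e]
    have := sub_pos.2 hlin
    positivity
  have chain : ∀ (C : ℝ) (m k : ℕ), 2 ≤ k → m ≤ k → 0 ≤ C →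
      C ≤ 2 * sylvesterPred k ^ 2 / (k + 1).factorial →
      C * (2 * sylvesterPred m) < 2 * sylvesterPred (k + 1) ^ 2 / (k + 2).factorial :=
    fun C m k hk hm hC h => by
    have h1 := sylvesterPred_mono hm
    have h2 := sylvesterPred_pos m
    refine lt_of_le_of_lt ?_ (step k hk)
    gcongr
  have main : ∀ (C : ℝ) (m k : ℕ), 2 ≤ k → m ≤ k → 0 ≤ C →
      C ≤ 2 * sylvesterPred k ^ 2 / (k + 1).factorial →
      ∀ j, C * (2 * sylvesterPred m) ^ (j + 1)
        < 2 * sylvesterPred (k + j + 1) ^ 2 / (k + j + 2).factorial := by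
    intro C m k hk hm hC h j
    have h2 := sylvesterPred_pos m
    induction j with
    | zero => simpa using chain C m k hk hm hC h
    | succ j ih =>
      rw [pow_succ, ← mul_assoc]
      exact chain _ m (k + j + 1) (by omega) (by omega) (by positivity) ih.le
  rcases Nat.lt_or_ge n 2 with h | h
  · obtain ⟨j, rfl⟩ := Nat.exists_eq_add_of_le hN
    rcases j with _ | j
    · interval_cases n <;>
        norm_num [weightBound, sylvesterPred_zero, sylvesterPred_one, sylvesterPred_three,
          Nat.factorial]
    · have h2 := sylvesterPred_pos n
      have hb := weightBound_pos n
      have := main (weightBound n / (n + 1).factorial * (2 * sylvesterPred n) ^ (3 - n)) n 3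
        (by omega) (by omega) (by positivity) (by
          interval_cases n <;>
            norm_num [weightBound, sylvesterPred_zero, sylvesterPred_one, sylvesterPred_three,
              Nat.factorial]) j
      rw [mul_assoc, ← pow_add] at this
      rw [show 3 + (j + 1) - n = 3 - n + (j + 1) by omega]
      exact this
  · obtain ⟨j, rfl⟩ := Nat.exists_eq_add_of_lt hn
    rw [show n + j + 1 - n = j + 1 by omega]
    exact main _ n n h le_rfl (div_nonneg (weightBound_pos n).le (by positivity))
      (by rw [weightBound_of_two_le h]) j

/-- Minkowski's theorem on linear forms, for the forms `m ↦ m i - β i * ∑ k, m k`. -/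
theorem exists_int_abs_sub_mul_sum_lt {ι : Type*} [Fintype ι] (β : ι → ℝ)
    (hpos : ∀ i, 0 < β i) (hsum : ∑ i, β i < 1) (h : 1 - ∑ i, β i < ∏ i, β i) :
    ∃ m : ι → ℤ, m ≠ 0 ∧ ∀ i, |(m i : ℝ) - β i * ∑ k, (m k : ℝ)| < β i := by
  classical
  set M : Matrix ι ι ℝ := fun k i => (1 : Matrix ι ι ℝ) k i - β i with hM
  have hdet : M.det = 1 - ∑ i, β i := by
    have : M = 1 + Matrix.replicateCol Unit (fun _ => (1 : ℝ))
        * Matrix.replicateRow Unit (fun i => -β i) := by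
      ext k i
      simp [hM, Matrix.mul_apply, sub_eq_add_neg]
    rw [this, Matrix.det_one_add_replicateCol_mul_replicateRow]
    simp [dotProduct, sub_eq_add_neg]
  have hdet0 : 0 < M.det := by rw [hdet]; linarith
  have hli : LinearIndependent ℝ M :=
    Matrix.linearIndependent_rows_iff_isUnit.2
      ((Matrix.isUnit_iff_isUnit_det M).2 (isUnit_iff_ne_zero.2 hdet0.ne'))
  have hne : Nonempty ι := by
    by_contra hcon
    rw [not_nonempty_iff] at hcon
    simp at h
  set b : Module.Basis ι ℝ (ι → ℝ) :=
    basisOfPiSpaceOfLinearIndependent hli with hb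
  have hbM : ⇑b = M := coe_basisOfPiSpaceOfLinearIndependent hli
  set s : Set (ι → ℝ) := Set.univ.pi fun i => Set.Ioo (-β i) (β i) with hs
  have hvol : volume s = ENNReal.ofReal (∏ i, β i) * 2 ^ Module.finrank ℝ (ι → ℝ) := by
    rw [hs, Real.volume_pi_Ioo, Module.finrank_fintype_fun_eq_card,
      ENNReal.ofReal_prod_of_nonneg (fun i _ => (hpos i).le), ← Finset.card_univ,
      ← Finset.prod_const, ← Finset.prod_mul_distrib]
    refine Finset.prod_congr rfl fun i _ => ?_
    rw [show β i - -β i = β i * 2 by ring, ENNReal.ofReal_mul (hpos i).le]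
    simp
  have : Countable (Submodule.span ℤ (Set.range b)).toAddSubgroup :=
    inferInstanceAs (Countable (Submodule.span ℤ (Set.range b)))
  obtain ⟨x, hx0, hx⟩ := exists_ne_zero_mem_lattice_of_measure_mul_two_pow_lt_measure
    (ZSpan.isAddFundamentalDomain' b volume) (s := s)
    (fun x hx => by
      simp only [hs, Set.mem_univ_pi, Set.mem_Ioo, Pi.neg_apply] at hx ⊢
      exact fun i => ⟨by linarith [(hx i).2], by linarith [(hx i).1]⟩)
    (convex_pi fun i _ => convex_Ioo _ _)
    (by
      rw [ZSpan.volume_fundamentalDomain, hvol, hbM]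
      refine (ENNReal.mul_lt_mul_iff_left (by simp) (by finiteness)).2 ?_
      rw [show (Matrix.of M) = M from rfl, abs_of_pos hdet0, hdet]
      exact (ENNReal.ofReal_lt_ofReal_iff (Finset.prod_pos fun i _ => hpos i)).2 h)
  obtain ⟨c, hc⟩ := (Submodule.mem_span_range_iff_exists_fun ℤ).1 x.2
  refine ⟨c, ?_, fun i => ?_⟩
  · rintro rfl
    apply hx0
    ext1
    rw [← hc]
    simp
  · have hxi := Set.mem_univ_pi.1 hx i
    rw [← hc, hbM] at hxi
    have : (∑ k, c k • M k) i = (c i : ℝ) - β i * ∑ k, (c k : ℝ) := by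
      simp [hM, mul_sub, Matrix.one_apply, Finset.sum_sub_distrib, Finset.mul_sum, mul_comm]
    rw [this] at hxi
    exact abs_lt.2 hxi

theorem isLatticePt_zero {d : ℕ} : IsLatticePt (0 : Fin d → ℝ) := fun _ => ⟨0, by simp⟩

theorem IsLatticePt.add {d : ℕ} {x y : Fin d → ℝ} (hx : IsLatticePt x) (hy : IsLatticePt y) :
    IsLatticePt (x + y) := fun i => by
  obtain ⟨a, ha⟩ := hx i
  obtain ⟨b, hb⟩ := hy i
  exact ⟨a + b, by simp [ha, hb]⟩

theorem IsLatticePt.int_smul {d : ℕ} {x : Fin d → ℝ} (hx : IsLatticePt x) (n : ℤ) :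
    IsLatticePt ((n : ℝ) • x) := fun i => by
  obtain ⟨a, ha⟩ := hx i
  exact ⟨n * a, by simp [ha]⟩

theorem isLatticePt_sum {d : ℕ} {ι : Type*} (s : Finset ι) (x : ι → Fin d → ℝ)
    (hx : ∀ i ∈ s, IsLatticePt (x i)) : IsLatticePt (∑ i ∈ s, x i) :=
  Finset.sum_induction x IsLatticePt (fun _ _ => IsLatticePt.add) isLatticePt_zero hx

/-- A minimal positive linear relation between vectors, normalized so that the coefficients have
sum one. -/
structure IsCircuit {E : Type*} [AddCommGroup E] [Module ℝ E] {k : ℕ} (v : Fin k → E)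
    (β : Fin k → ℝ) : Prop where
  pos : ∀ i, 0 < β i
  sum_eq_one : ∑ i, β i = 1
  sum_smul : ∑ i, β i • v i = 0
  unique : ∀ c : Fin k → ℝ, ∑ i, c i • v i = 0 → ∃ t, ∀ i, c i = t * β i

namespace IsCircuit

variable {E : Type*} [AddCommGroup E] [Module ℝ E] {k : ℕ} {v : Fin k → E} {β : Fin k → ℝ}

theorem comp_perm (h : IsCircuit v β) (σ : Equiv.Perm (Fin k)) : IsCircuit (v ∘ σ) (β ∘ σ) where
  pos i := h.pos _
  sum_eq_one := by simpa using (Equiv.sum_comp σ β).trans h.sum_eq_one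
  sum_smul := (Equiv.sum_comp σ fun i => β i • v i).trans h.sum_smul
  unique c hc := by
    obtain ⟨t, ht⟩ := h.unique (c ∘ σ.symm) (by
      rw [← hc, ← Equiv.sum_comp σ]
      simp)
    exact ⟨t, fun i => by simpa using ht (σ i)⟩

theorem exists_antitone (h : IsCircuit v β) :
    ∃ σ : Equiv.Perm (Fin k), IsCircuit (v ∘ σ) (β ∘ σ) ∧ Antitone (β ∘ σ) := by
  refine ⟨Tuple.sort (-β), h.comp_perm _, fun i j hij => ?_⟩
  have := Tuple.monotone_sort (-β) hij
  simpa using this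

theorem linearIndependent_castSucc {k : ℕ} {v : Fin (k + 1) → E} {β : Fin (k + 1) → ℝ}
    (h : IsCircuit v β) : LinearIndependent ℝ fun i : Fin k => v i.castSucc := by
  rw [Fintype.linearIndependent_iff]
  intro g hg i
  obtain ⟨t, ht⟩ := h.unique (Fin.snoc g 0) (by simp [Fin.sum_univ_castSucc, hg])
  have h0 : t = 0 := by
    have := ht (Fin.last k)
    simp only [Fin.snoc_last] at this
    exact (mul_eq_zero.1 this.symm).resolve_right (h.pos _).ne'
  simpa [h0] using ht i.castSucc

theorem prod_le_one_sub_sum {d : ℕ} {k : ℕ} {v : Fin k → Fin d → ℝ} {β : Fin k → ℝ}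
    (h : IsCircuit v β) (hv : ∀ i, IsLatticePt (v i))
    (hlat : ∀ c : Fin k → ℝ, (∀ i, 0 < c i) → ∑ i, c i = 1 → IsLatticePt (∑ i, c i • v i) →
      ∑ i, c i • v i = 0)
    (J : Finset (Fin k)) (hJ : J ≠ Finset.univ) :
    ∏ i ∈ J, β i ≤ 1 - ∑ i ∈ J, β i := by
  obtain ⟨p, hp⟩ : ∃ p, p ∉ J := by
    by_contra! hcon
    exact hJ (Finset.eq_univ_of_forall hcon)
  by_contra! hlt
  have hsum : ∑ i ∈ J, β i < 1 := by
    rw [← h.sum_eq_one]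
    exact Finset.sum_lt_sum_of_subset (Finset.subset_univ J) (Finset.mem_univ p) hp (h.pos p)
      fun i _ _ => (h.pos i).le
  obtain ⟨m, hm0, hm⟩ := exists_int_abs_sub_mul_sum_lt (fun i : J => β i) (fun i => h.pos i)
    (by rwa [Finset.sum_coe_sort J β])
    (by rwa [Finset.sum_coe_sort J β, Finset.prod_coe_sort J β])
  obtain ⟨m, hm0, hm, hS⟩ : ∃ m : J → ℤ, m ≠ 0 ∧
      (∀ i, |(m i : ℝ) - β i * ∑ k, (m k : ℝ)| < β i) ∧ ∑ k, (m k : ℝ) ≤ 0 := by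
    rcases le_total (∑ k, (m k : ℝ)) 0 with hle | hle
    · exact ⟨m, hm0, hm, hle⟩
    · refine ⟨-m, neg_ne_zero.2 hm0, fun i => ?_, by simpa using hle⟩
      rw [← abs_neg]
      convert hm i using 2
      simp
      ring
  set n : Fin k → ℤ := fun i => if hi : i ∈ J then m ⟨i, hi⟩ else 0 with hn
  have hnsum : ∑ i, (n i : ℝ) = ∑ i, (m i : ℝ) := by
    rw [← Finset.sum_subset (Finset.subset_univ J) (fun i _ hi => by simp [hn, hi]),
      ← Finset.sum_coe_sort J]
    exact Finset.sum_congr rfl fun i _ => by simp [hn]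
  set S := ∑ i, (m i : ℝ) with hSdef
  set c : Fin k → ℝ := fun i => β i - β i * S + n i with hc
  have hcpos : ∀ i, 0 < c i := fun i => by
    have hi0 := h.pos i
    by_cases hi : i ∈ J
    · have := (abs_lt.1 (hm ⟨i, hi⟩)).1
      simp only [hc, hn, dif_pos hi]
      linarith
    · simp only [hc, hn, dif_neg hi]
      push_cast
      nlinarith
  have hcsum : ∑ i, c i = 1 := by
    simp only [hc, Finset.sum_add_distrib, Finset.sum_sub_distrib, ← Finset.sum_mul,
      h.sum_eq_one, hnsum]
    ring
  have hpt : ∑ i, c i • v i = ∑ i, (n i : ℝ) • v i := by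
    simp only [hc, add_smul, sub_smul, Finset.sum_add_distrib, Finset.sum_sub_distrib,
      h.sum_smul, mul_comm _ S, mul_smul, ← Finset.smul_sum]
    simp
  have hzero := hlat c hcpos hcsum (by
    rw [hpt]
    exact isLatticePt_sum _ _ fun i _ => (hv i).int_smul _)
  obtain ⟨t, ht⟩ := h.unique c hzero
  have ht1 : t = 1 := by
    have : ∑ i, c i = t := by
      rw [Finset.sum_congr rfl fun i _ => ht i, ← Finset.mul_sum, h.sum_eq_one, mul_one]
    linarith
  have hS0 : S = 0 := by
    have := ht p
    simp only [hc, hn, dif_neg hp, ht1] at this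
    push_cast at this
    have h2 : β p * S = 0 := by linarith
    exact (mul_eq_zero.1 h2).resolve_left (h.pos p).ne'
  apply hm0
  funext i
  have := ht i
  simp only [hc, hn, dif_pos i.2, ht1, hS0] at this
  have h2 : (m i : ℝ) = 0 := by
    have : ((m ⟨i, i.2⟩ : ℤ) : ℝ) = 0 := by linarith
    exact this
  exact_mod_cast h2

end IsCircuit

/-- Every vector with a positive coefficient in a nonnegative linear relation is part of a
circuit. -/
theorem exists_isCircuit {E : Type*} [AddCommGroup E] [Module ℝ E] [DecidableEq E]
    (V : Finset E) (c : E → ℝ) (hc : ∀ u ∈ V, 0 ≤ c u) (hrel : ∑ u ∈ V, c u • u = 0)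
    {v : E} (hvV : v ∈ V) (hv : 0 < c v) :
    ∃ (k : ℕ) (w : Fin k → E) (β : Fin k → ℝ), IsCircuit w β ∧ (∀ i, w i ∈ V) ∧
      ∃ i, w i = v := by
  classical
  have hrestr : ∀ (S : Finset E) (a : E → ℝ), (∀ u ∈ S, 0 ≤ a u) →
      ∑ u ∈ S, a u • u = 0 → ∑ u ∈ S.filter (fun u => 0 < a u), a u • u = 0 := by
    intro S a ha hsum
    rw [← hsum]
    refine Finset.sum_subset (Finset.filter_subset _ _) fun u hu hu' => ?_
    have : a u = 0 := le_antisymm (not_lt.1 fun h => hu' (Finset.mem_filter.2 ⟨hu, h⟩)) (ha u hu)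
    rw [this, zero_smul]
  set F := V.powerset.filter fun S => v ∈ S ∧
    ∃ a : E → ℝ, (∀ u ∈ S, 0 < a u) ∧ ∑ u ∈ S, a u • u = 0 with hF
  have hFne : F.Nonempty := ⟨V.filter fun u => 0 < c u, by
    simp only [hF, Finset.mem_filter, Finset.mem_powerset]
    exact ⟨Finset.filter_subset _ _, ⟨hvV, hv⟩, c, fun u hu => hu.2, hrestr V c hc hrel⟩⟩
  obtain ⟨S, hSF, hmin⟩ := Finset.exists_min_image F Finset.card hFne
  simp only [hF, Finset.mem_filter, Finset.mem_powerset] at hSF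
  obtain ⟨hSV, hvS, a, ha, hasum⟩ := hSF
  have hnopos : ∀ b : E → ℝ, ∑ u ∈ S, b u • u = 0 → b v = 0 → ∀ u ∈ S, b u ≤ 0 := by
    intro b hb hbv
    by_contra! hcon
    obtain ⟨u₁, hu₁, hbu₁⟩ := hcon
    obtain ⟨u₀, hu₀, hu₀min⟩ := Finset.exists_min_image (S.filter fun u => 0 < b u)
      (fun u => a u / b u) ⟨u₁, Finset.mem_filter.2 ⟨hu₁, hbu₁⟩⟩
    obtain ⟨hu₀S, hbu₀⟩ := Finset.mem_filter.1 hu₀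
    set t := a u₀ / b u₀ with ht
    have ht0 : 0 < t := div_pos (ha u₀ hu₀S) hbu₀
    set a' : E → ℝ := fun u => a u - t * b u with ha'
    have ha'0 : ∀ u ∈ S, 0 ≤ a' u := fun u hu => by
      rcases lt_or_ge 0 (b u) with h | h
      · have := hu₀min u (Finset.mem_filter.2 ⟨hu, h⟩)
        rw [le_div_iff₀ h] at this
        simp only [ha']
        linarith
      · have := ha u hu
        simp only [ha']
        nlinarith
    have ha'sum : ∑ u ∈ S, a' u • u = 0 := by
      simp only [ha', sub_smul, mul_smul, Finset.sum_sub_distrib, ← Finset.smul_sum, hasum, hb]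
      simp
    have hmem : S.filter (fun u => 0 < a' u) ∈ F := by
      simp only [hF, Finset.mem_filter, Finset.mem_powerset]
      refine ⟨(Finset.filter_subset _ _).trans hSV, ⟨hvS, ?_⟩, a', fun u hu => hu.2,
        hrestr S a' ha'0 ha'sum⟩
      simp only [ha', hbv]
      simpa using ha v hvS
    have hlt : (S.filter fun u => 0 < a' u).card < S.card := by
      refine Finset.card_lt_card (Finset.filter_ssubset.2 ⟨u₀, hu₀S, ?_⟩)
      simp only [ha', ht]
      rw [div_mul_cancel₀ _ hbu₀.ne']
      simp
    exact (hmin _ hmem).not_gt hlt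
  have huniq : ∀ b : E → ℝ, ∑ u ∈ S, b u • u = 0 → ∀ u ∈ S, b u = b v / a v * a u := by
    intro b hb u hu
    have hav := (ha v hvS).ne'
    have h1 := hnopos (fun u => b u - b v / a v * a u)
      (by
        simp only [sub_smul, mul_smul, Finset.sum_sub_distrib, ← Finset.smul_sum, hasum, hb]
        simp) (by field_simp; simp) u hu
    have h2 := hnopos (fun u => b v / a v * a u - b u)
      (by
        simp only [sub_smul, mul_smul, Finset.sum_sub_distrib, ← Finset.smul_sum, hasum, hb]
        simp) (by field_simp; simp) u hu
    linarith
  set A := ∑ u ∈ S, a u with hA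
  have hA0 : 0 < A := Finset.sum_pos ha ⟨v, hvS⟩
  have hsumR : ∀ f : E → ℝ, ∑ i, f (S.equivFin.symm i : E) = ∑ u ∈ S, f u := fun f => by
    rw [← Finset.sum_coe_sort S f]
    exact Equiv.sum_comp S.equivFin.symm (fun u : S => f u)
  have hsumE : ∀ f : E → E, ∑ i, f (S.equivFin.symm i : E) = ∑ u ∈ S, f u := fun f => by
    rw [← Finset.sum_coe_sort S f]
    exact Equiv.sum_comp S.equivFin.symm (fun u : S => f u)
  refine ⟨S.card, fun i => S.equivFin.symm i, fun i => a (S.equivFin.symm i : E) / A, ?_,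
    fun i => hSV (S.equivFin.symm i).2, S.equivFin ⟨v, hvS⟩, by simp⟩
  constructor
  · exact fun i => div_pos (ha _ (S.equivFin.symm i).2) hA0
  · rw [hsumR fun u => a u / A, ← Finset.sum_div]
    exact div_self hA0.ne'
  · rw [hsumE fun u => (a u / A) • u]
    simp only [div_eq_inv_mul, mul_smul, ← Finset.smul_sum, hasum, smul_zero]
  · intro b hb
    set b' : E → ℝ := fun u => if hu : u ∈ S then b (S.equivFin ⟨u, hu⟩) else 0 with hb'
    have hb'eq : ∀ i, b' (S.equivFin.symm i : E) = b i := fun i => by simp [hb']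
    have hb's : ∑ u ∈ S, b' u • u = 0 := by
      rw [← hsumE fun u => b' u • u, ← hb]
      exact Finset.sum_congr rfl fun i _ => by rw [hb'eq]
    refine ⟨b' v / a v * A, fun i => ?_⟩
    rw [← hb'eq, huniq b' hb's _ (S.equivFin.symm i).2]
    field_simp

theorem exists_sequence_of_antitone {n : ℕ} (β : Fin (n + 2) → ℝ) (hpos : ∀ i, 0 < β i)
    (hanti : Antitone β) (hsum : ∑ i, β i = 1)
    (hps : ∀ J : Finset (Fin (n + 2)), J ≠ Finset.univ → ∏ i ∈ J, β i ≤ 1 - ∑ i ∈ J, β i) :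
    ∃ x : ℕ → ℝ, (∀ i : Fin (n + 2), x i = β i) ∧ (∀ i ≤ n + 1, 0 < x i) ∧
      (∀ i ≤ n, x (i + 1) ≤ x i) ∧ ∑ i ∈ Finset.range (n + 2), x i = 1 ∧
      ∀ j ≤ n + 1, ∏ i ∈ Finset.range j, x i ≤ 1 - ∑ i ∈ Finset.range j, x i := by
  set x : ℕ → ℝ := fun i => if h : i < n + 2 then β ⟨i, h⟩ else 0 with hx
  have hxβ : ∀ i : Fin (n + 2), x i = β i := fun i => by simp [hx]
  refine ⟨x, hxβ, fun i hi => ?_, fun i hi => ?_, ?_, fun j hj => ?_⟩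
  · exact (hpos ⟨i, by omega⟩).trans_eq (hxβ ⟨i, by omega⟩).symm
  · rw [← Fin.val_mk (show i < n + 2 by omega), hxβ,
      show x (i + 1) = β ⟨i + 1, by omega⟩ from hxβ ⟨i + 1, by omega⟩]
    exact hanti (Fin.mk_le_mk.2 (Nat.le_succ i))
  · rw [Finset.sum_range, ← hsum]
    exact Finset.sum_congr rfl fun i _ => hxβ i
  · have hmap : (Finset.univ.filter fun i : Fin (n + 2) => (i : ℕ) < j).map
        Fin.valEmbedding = Finset.range j := by
      ext i
      simp only [Finset.mem_map, Finset.mem_filter, Finset.mem_univ, true_and,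
        Fin.valEmbedding_apply, Finset.mem_range]
      exact ⟨by rintro ⟨a, ha, rfl⟩; exact ha, fun hi => ⟨⟨i, by omega⟩, hi, rfl⟩⟩
    have := hps (Finset.univ.filter fun i : Fin (n + 2) => (i : ℕ) < j) (fun h => by
      have := Finset.mem_univ (Fin.last (n + 1))
      rw [← h] at this
      simp at this
      omega)
    rw [← hmap, Finset.prod_map, Finset.sum_map]
    simpa [hxβ] using this

theorem inv_weightBound_le_prod_castSucc {n : ℕ} (β : Fin (n + 2) → ℝ) (hpos : ∀ i, 0 < β i)
    (hanti : Antitone β) (hsum : ∑ i, β i = 1)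
    (hps : ∀ J : Finset (Fin (n + 2)), J ≠ Finset.univ → ∏ i ∈ J, β i ≤ 1 - ∑ i ∈ J, β i) :
    (weightBound n)⁻¹ ≤ ∏ i : Fin (n + 1), β i.castSucc := by
  obtain ⟨x, hxβ, h1, h2, h3, h4⟩ := exists_sequence_of_antitone β hpos hanti hsum hps
  have := inv_weightBound_le_prod x n h1 h2 h3 h4
  rw [Finset.prod_range] at this
  exact this.trans_eq (Finset.prod_congr rfl fun i _ => hxβ i.castSucc)

theorem eq_sylvesterWeight_of_prod_castSucc_eq {n : ℕ} (hn : 3 ≤ n) (β : Fin (n + 2) → ℝ)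
    (hpos : ∀ i, 0 < β i) (hanti : Antitone β) (hsum : ∑ i, β i = 1)
    (hps : ∀ J : Finset (Fin (n + 2)), J ≠ Finset.univ → ∏ i ∈ J, β i ≤ 1 - ∑ i ∈ J, β i)
    (heq : ∏ i : Fin (n + 1), β i.castSucc = (weightBound n)⁻¹) (i : Fin (n + 1)) :
    β i.castSucc = sylvesterWeight n n i := by
  obtain ⟨x, hxβ, h1, h2, h3, h4⟩ := exists_sequence_of_antitone β hpos hanti hsum hps
  have := eq_sylvesterWeight_of_prod_eq x n hn h1 h2 h3 h4 (by
    rw [Finset.prod_range, ← heq]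
    exact Finset.prod_congr rfl fun i _ => hxβ i.castSucc)
  rw [← this i (by omega), ← hxβ]
  rfl

theorem inv_two_mul_sylvesterPred_le_castSucc {n : ℕ} (β : Fin (n + 2) → ℝ)
    (hpos : ∀ i, 0 < β i) (hanti : Antitone β) (hsum : ∑ i, β i = 1)
    (hps : ∀ J : Finset (Fin (n + 2)), J ≠ Finset.univ → ∏ i ∈ J, β i ≤ 1 - ∑ i ∈ J, β i)
    (i : Fin (n + 1)) : (2 * sylvesterPred n)⁻¹ ≤ β i.castSucc := by
  obtain ⟨x, hxβ, h1, h2, h3, h4⟩ := exists_sequence_of_antitone β hpos hanti hsum hps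
  have h := inv_two_mul_sylvesterPred_le x n h1 h2 h3 h4
  have h5 := h2 n le_rfl
  have h6 : x n = β (Fin.last n).castSucc := hxβ (Fin.last n).castSucc
  have h7 : β (Fin.last n).castSucc ≤ β i.castSucc := hanti (Fin.castSucc_le_castSucc_iff.2 i.le_last)
  linarith

theorem mem_polarDual_convexHull {d : ℕ} {U : Set (Fin d → ℝ)} {y : Fin d → ℝ}
    (h : ∀ u ∈ U, -1 ≤ y ⬝ᵥ u) : y ∈ polarDual (convexHull ℝ U) := by
  have hconv : Convex ℝ {x : Fin d → ℝ | -1 ≤ y ⬝ᵥ x} :=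
    convex_halfSpace_ge (f := fun x => y ⬝ᵥ x)
      ⟨fun a b => dotProduct_add y a b, fun c a => dotProduct_smul c y a⟩ _
  exact fun x hx => convexHull_min (fun u hu => h u hu) hconv hx

/-- The origin is the only lattice point in the interior of the dual of a lattice polytope. -/
theorem eq_zero_of_smul_mem_polarDual {d : ℕ} {P : Set (Fin d → ℝ)} (hP : IsLatticePolytope P)
    (h0 : 0 ∈ interior P) {y : Fin d → ℝ} (hy : IsLatticePt y) {c : ℝ} (hc : 1 < c)
    (hcy : c • y ∈ polarDual P) : y = 0 := by
  obtain ⟨U, hU, rfl⟩ := hP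
  have hnonneg : ∀ x ∈ convexHull ℝ (U : Set (Fin d → ℝ)), 0 ≤ y ⬝ᵥ x := by
    have hconv : Convex ℝ {x : Fin d → ℝ | 0 ≤ y ⬝ᵥ x} :=
      convex_halfSpace_ge (f := fun x => y ⬝ᵥ x)
        ⟨fun a b => dotProduct_add y a b, fun c a => dotProduct_smul c y a⟩ _
    refine fun x hx => convexHull_min (fun u hu => ?_) hconv hx
    choose p hp using hy
    choose q hq using hU u hu
    have hlat : y ⬝ᵥ u = ((∑ i, p i * q i : ℤ) : ℝ) := by
      simp [dotProduct, hp, hq]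
    have h1 : -1 ≤ (c • y) ⬝ᵥ u := hcy u (subset_convexHull ℝ _ hu)
    rw [smul_dotProduct, smul_eq_mul, hlat] at h1
    change 0 ≤ y ⬝ᵥ u
    rw [hlat]
    have h2 : (-1 : ℤ) < ∑ i, p i * q i := by
      by_contra! hle
      have : ((∑ i, p i * q i : ℤ) : ℝ) ≤ -1 := by exact_mod_cast hle
      nlinarith
    exact_mod_cast (by omega : (0 : ℤ) ≤ ∑ i, p i * q i)
  have hcont : ContinuousAt (fun ε : ℝ => -ε • y) 0 := by fun_prop
  have hev : ∀ᶠ ε : ℝ in nhds 0, -ε • y ∈ convexHull ℝ (U : Set (Fin d → ℝ)) :=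
    hcont.eventually (by
      simp only [neg_zero, zero_smul]
      exact mem_interior_iff_mem_nhds.1 h0)
  obtain ⟨ε, hε0, hε⟩ := (hev.filter_mono nhdsWithin_le_nhds |>.and
    (self_mem_nhdsWithin (s := Set.Ioi (0 : ℝ)))).exists
  have := hnonneg _ hε0
  rw [dotProduct_smul, smul_eq_mul] at this
  have hε' : 0 < ε := hε
  have h3 : 0 ≤ y ⬝ᵥ y := Finset.sum_nonneg fun i _ => mul_self_nonneg (y i)
  have h4 : y ⬝ᵥ y = 0 := by nlinarith
  exact dotProduct_self_eq_zero.1 h4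

theorem exists_neg_smul_mem_polarDual {d : ℕ} {P : Set (Fin d → ℝ)} (hP : IsLatticePolytope P)
    (v : Fin d → ℝ) : ∃ ε : ℝ, 0 < ε ∧ -ε • v ∈ polarDual P := by
  obtain ⟨U, -, rfl⟩ := hP
  have hM : 0 < 1 + ∑ u ∈ U, |v ⬝ᵥ u| := by positivity
  refine ⟨(1 + ∑ u ∈ U, |v ⬝ᵥ u|)⁻¹, by positivity, mem_polarDual_convexHull fun u hu => ?_⟩
  rw [smul_dotProduct, smul_eq_mul, neg_mul, neg_le_neg_iff, inv_mul_le_one₀ hM]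
  have := Finset.single_le_sum (f := fun u => |v ⬝ᵥ u|) (fun i _ => abs_nonneg _) hu
  have h2 := le_abs_self (v ⬝ᵥ u)
  linarith

section Polar

variable {d : ℕ} {P : Set (Fin d → ℝ)} {V : Finset (Fin d → ℝ)}

theorem span_vertices_polarDual (hP : IsLatticePolytope P)
    (hV : polarDual P = convexHull ℝ (V : Set (Fin d → ℝ))) :
    Submodule.span ℝ (V : Set (Fin d → ℝ)) = ⊤ := by
  refine eq_top_iff.2 fun v _ => ?_
  obtain ⟨ε, hε, hmem⟩ := exists_neg_smul_mem_polarDual hP v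
  rw [hV] at hmem
  have := convexHull_min (t := (Submodule.span ℝ (V : Set (Fin d → ℝ)) : Set (Fin d → ℝ)))
    Submodule.subset_span (Submodule.convex _) hmem
  exact (Submodule.smul_mem_iff _ (neg_ne_zero.2 hε.ne')).1 this

theorem exists_isCircuit_vertices_polarDual (hP : IsLatticePolytope P)
    (hV : polarDual P = convexHull ℝ (V : Set (Fin d → ℝ))) {v : Fin d → ℝ} (hvV : v ∈ V)
    (hv : v ≠ 0) :
    ∃ (n : ℕ) (w : Fin (n + 2) → Fin d → ℝ) (β : Fin (n + 2) → ℝ),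
      IsCircuit w β ∧ Antitone β ∧ (∀ i, w i ∈ V) ∧ ∃ i, w i = v := by
  classical
  obtain ⟨ε, hε, hmem⟩ := exists_neg_smul_mem_polarDual hP v
  rw [hV, Finset.mem_convexHull'] at hmem
  obtain ⟨c, hc0, -, hc⟩ := hmem
  obtain ⟨k, w, β, h, hw, i, hi⟩ := exists_isCircuit V (fun u => c u + if u = v then ε else 0)
    (fun u hu => add_nonneg (hc0 u hu) (by split_ifs <;> linarith))
    (by
      simp only [add_smul, Finset.sum_add_distrib, hc, ite_smul, zero_smul]
      simp [hvV]) hvV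
    (by
      have := hc0 v hvV
      simp
      linarith)
  obtain ⟨σ, hσ, hanti⟩ := h.exists_antitone
  rcases k with _ | _ | n
  · exact i.elim0
  · exfalso
    have h1 := h.sum_smul
    have h2 := h.pos 0
    rw [Fin.sum_univ_one] at h1
    rw [Fin.fin_one_eq_zero i] at hi
    rw [hi] at h1
    exact hv ((smul_eq_zero.1 h1).resolve_left h2.ne')
  · exact ⟨n, w ∘ σ, β ∘ σ, hσ, hanti, fun i => hw _, σ.symm i, by simpa using hi⟩

theorem IsCircuit.prod_le_of_vertices_polarDual (hP : IsLatticePolytope P)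
    (h0 : 0 ∈ interior P) (hV : polarDual P = convexHull ℝ (V : Set (Fin d → ℝ)))
    (hVint : ∀ v ∈ V, IsLatticePt v) {k : ℕ} {w : Fin k → Fin d → ℝ} {β : Fin k → ℝ}
    (h : IsCircuit w β) (hw : ∀ i, w i ∈ V) (J : Finset (Fin k)) (hJ : J ≠ Finset.univ) :
    ∏ i ∈ J, β i ≤ 1 - ∑ i ∈ J, β i := by
  refine h.prod_le_one_sub_sum (fun i => hVint _ (hw i)) (fun c hc hcsum hlat => ?_) J hJ
  have hne : (Finset.univ : Finset (Fin k)).Nonempty := by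
    by_contra hcon
    rw [Finset.not_nonempty_iff_eq_empty] at hcon
    simp [hcon] at hcsum
  obtain ⟨p, -, hp⟩ := Finset.exists_min_image Finset.univ c hne
  have hβ1 : ∀ i, β i ≤ 1 := fun i => by
    rw [← h.sum_eq_one]
    exact Finset.single_le_sum (fun i _ => (h.pos i).le) (Finset.mem_univ i)
  refine eq_zero_of_smul_mem_polarDual hP h0 hlat (c := 1 + c p) (by linarith [hc p]) ?_
  have heq : (1 + c p) • ∑ i, c i • w i = ∑ i, ((1 + c p) * c i - c p * β i) • w i := by
    simp only [sub_smul, mul_smul, Finset.sum_sub_distrib, ← Finset.smul_sum, h.sum_smul]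
    simp
  rw [heq, hV]
  refine (convex_convexHull ℝ _).sum_mem (fun i _ => ?_) ?_
    fun i _ => subset_convexHull ℝ _ (hw i)
  · have h1 := hp i (Finset.mem_univ i)
    nlinarith [hc p, hc i, h.pos i, hβ1 i, mul_pos (hc p) (hc i)]
  · rw [Finset.sum_sub_distrib, ← Finset.mul_sum, ← Finset.mul_sum, hcsum, h.sum_eq_one]
    ring

end Polar

/-- The simplex cut off from the nonnegative orthant by the half-space `∑ i, β i * z i ≤ t`. -/
def cornerSimplex {k : ℕ} (β : Fin k → ℝ) (t : ℝ) : Set (Fin k → ℝ) :=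
  {z | (∀ i, 0 ≤ z i) ∧ ∑ i, β i * z i ≤ t}

theorem isClosed_cornerSimplex {k : ℕ} (β : Fin k → ℝ) (t : ℝ) :
    IsClosed (cornerSimplex β t) := by
  refine IsClosed.and ?_ (isClosed_le (by fun_prop) continuous_const)
  simp only [Set.ofPred_forall]
  exact isClosed_iInter fun i => isClosed_le continuous_const (continuous_apply i)

theorem convex_cornerSimplex {k : ℕ} (β : Fin k → ℝ) (t : ℝ) : Convex ℝ (cornerSimplex β t) := by
  intro x hx y hy a b ha hb hab
  refine ⟨fun i => ?_, ?_⟩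
  · have h1 := hx.1 i
    have h2 := hy.1 i
    simp only [Pi.add_apply, Pi.smul_apply, smul_eq_mul]
    positivity
  · have h : ∑ i, β i * (a • x + b • y) i = a * ∑ i, β i * x i + b * ∑ i, β i * y i := by
      rw [Finset.mul_sum, Finset.mul_sum, ← Finset.sum_add_distrib]
      refine Finset.sum_congr rfl fun i _ => ?_
      simp only [Pi.add_apply, Pi.smul_apply, smul_eq_mul]
      ring
    rw [h]
    have h1 := mul_le_mul_of_nonneg_left hx.2 ha
    have h2 := mul_le_mul_of_nonneg_left hy.2 hb
    have h3 : a * t + b * t = t := by rw [← add_mul, hab, one_mul]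
    linarith

theorem volume_cornerSimplex {k : ℕ} (β : Fin k → ℝ) (hβ : ∀ i, 0 < β i) {t : ℝ} (ht : 0 ≤ t) :
    volume (cornerSimplex β t) = ENNReal.ofReal (t ^ k / (k.factorial * ∏ i, β i)) := by
  induction k generalizing t with
  | zero =>
    have : cornerSimplex β t = Set.univ := by
      ext z
      simp [cornerSimplex, ht]
    rw [this, volume_pi, Measure.pi_univ]
    simp
  | succ k ih =>
    have h0 := hβ 0
    have hprod : 0 < ∏ i : Fin k, β i.succ := Finset.prod_pos fun i _ => hβ _
    set T : Set (ℝ × (Fin k → ℝ)) :=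
      {p | 0 ≤ p.1 ∧ p.2 ∈ cornerSimplex (fun i => β i.succ) (t - β 0 * p.1)} with hT
    have hTc : IsClosed T := by
      refine IsClosed.and (isClosed_le continuous_const continuous_fst)
        (IsClosed.and ?_ (isClosed_le (by fun_prop) (by fun_prop)))
      simp only [Set.ofPred_forall]
      exact isClosed_iInter fun i =>
        isClosed_le continuous_const ((continuous_apply i).comp continuous_snd)
    have hpre : cornerSimplex β t =
        (MeasurableEquiv.piFinSuccAbove (fun _ : Fin (k + 1) => ℝ) 0) ⁻¹' T := by
      ext z
      simp only [cornerSimplex, hT, Set.mem_preimage, Set.mem_ofPred_eq, Fin.forall_fin_succ,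
        Fin.sum_univ_succ, MeasurableEquiv.piFinSuccAbove_apply, Fin.insertNthEquiv_symm_apply,
        Fin.removeNth, Fin.zero_succAbove]
      rw [and_assoc, le_sub_iff_add_le']
    rw [hpre, (volume_preserving_piFinSuccAbove (fun _ : Fin (k + 1) => ℝ) 0).measure_preimage
      hTc.measurableSet.nullMeasurableSet, Measure.volume_eq_prod,
      Measure.prod_apply hTc.measurableSet]
    have hslice : ∀ s : ℝ, volume (Prod.mk s ⁻¹' T) = (Set.Icc 0 (t / β 0)).indicator
        (fun s => ENNReal.ofReal
          ((t - β 0 * s) ^ k / (k.factorial * ∏ i : Fin k, β i.succ))) s := fun s => by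
      by_cases hs : s ∈ Set.Icc 0 (t / β 0)
      · have h1 : 0 ≤ t - β 0 * s := by
          have := (le_div_iff₀ h0).1 hs.2
          linarith
        rw [Set.indicator_of_mem hs, ← ih (fun i => β i.succ) (fun i => hβ _) h1]
        congr 1
        ext z
        simp [hT, hs.1]
      · rw [Set.indicator_of_notMem hs]
        convert measure_empty (μ := volume)
        refine Set.eq_empty_of_forall_notMem fun z hz => hs ⟨hz.1, ?_⟩
        have h1 : 0 ≤ ∑ i : Fin k, β i.succ * z i :=
          Finset.sum_nonneg fun i _ => mul_nonneg (hβ _).le (hz.2.1 i)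
        have h2 := hz.2.2
        rw [le_div_iff₀ h0]
        simp only at h2
        linarith
    simp_rw [hslice]
    rw [lintegral_indicator measurableSet_Icc, ← ofReal_integral_eq_lintegral_ofReal,
      integral_Icc_eq_integral_Ioc, ← intervalIntegral.integral_of_le (by positivity),
      intervalIntegral.integral_div,
      intervalIntegral.integral_comp_sub_mul (fun x => x ^ k) h0.ne', integral_pow,
      Fin.prod_univ_succ, Nat.factorial_succ]
    · congr 1
      have h2 : t - β 0 * (t / β 0) = 0 := by field_simp; simp
      rw [h2]
      push_cast
      simp
      field_simp
    · exact ContinuousOn.integrableOn_Icc (by fun_prop)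
    · refine (ae_restrict_iff' measurableSet_Icc).2 (Filter.Eventually.of_forall fun s hs => ?_)
      have h1 : 0 ≤ t - β 0 * s := by
        have := (le_div_iff₀ h0).1 hs.2
        linarith
      exact div_nonneg (pow_nonneg h1 k) (by positivity)

theorem volume_setOf_castAdd_natAdd {m e : ℕ} (A : Set (Fin m → ℝ)) (B : Set (Fin e → ℝ)) :
    volume {z : Fin (m + e) → ℝ | (fun i => z (Fin.castAdd e i)) ∈ A ∧
      (fun j => z (Fin.natAdd m j)) ∈ B} = volume A * volume B := by
  have h1 := volume_measurePreserving_piCongrLeft (fun _ : Fin (m + e) => ℝ) finSumFinEquiv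
  have h2 := volume_measurePreserving_sumPiEquivProdPi_symm (fun _ : Fin m ⊕ Fin e => ℝ)
  rw [← h1.measure_preimage_equiv, ← h2.measure_preimage_equiv, ← Measure.prod_prod]
  change volume _ = volume _
  congr 1
  ext ⟨a, b⟩
  have ha : ∀ f : Fin m ⊕ Fin e → ℝ, ∀ i, (MeasurableEquiv.piCongrLeft
      (fun _ : Fin (m + e) => ℝ) finSumFinEquiv) f (Fin.castAdd e i) = f (Sum.inl i) :=
    fun f i => Equiv.piCongrLeft_apply_apply (fun _ => ℝ) finSumFinEquiv f (Sum.inl i)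
  have hb : ∀ f : Fin m ⊕ Fin e → ℝ, ∀ i, (MeasurableEquiv.piCongrLeft
      (fun _ : Fin (m + e) => ℝ) finSumFinEquiv) f (Fin.natAdd m i) = f (Sum.inr i) :=
    fun f i => Equiv.piCongrLeft_apply_apply (fun _ => ℝ) finSumFinEquiv f (Sum.inr i)
  simp only [Set.mem_preimage, Set.mem_ofPred_eq, Set.mem_prod, ha, hb]
  rfl

theorem IsCircuit.sum_mul_one_add_dotProduct {d k : ℕ} {w : Fin k → Fin d → ℝ} {β : Fin k → ℝ}
    (h : IsCircuit w β) (x : Fin d → ℝ) : ∑ i, β i * (1 + w i ⬝ᵥ x) = 1 := by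
  have h1 : ∑ i, β i * (w i ⬝ᵥ x) = 0 := by
    have : (∑ i, β i • w i) ⬝ᵥ x = 0 := by rw [h.sum_smul, zero_dotProduct]
    rw [sum_dotProduct] at this
    simpa [smul_dotProduct] using this
  simp only [mul_add, mul_one, Finset.sum_add_distrib, h.sum_eq_one, h1, add_zero]

theorem exists_basis_vertices_polarDual {d : ℕ} (hd : 0 < d) {P : Set (Fin d → ℝ)}
    {V : Finset (Fin d → ℝ)} (hP : IsLatticePolytope P) (h0 : 0 ∈ interior P)
    (hV : polarDual P = convexHull ℝ (V : Set (Fin d → ℝ))) (hVint : ∀ v ∈ V, IsLatticePt v) :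
    ∃ (n e : ℕ) (β : Fin (n + 2) → ℝ) (b : Fin (n + 1 + e) → Fin d → ℝ), n + 1 + e = d ∧
      (∀ i, 0 < β i) ∧ Antitone β ∧ ∑ i, β i = 1 ∧
      (∀ J : Finset (Fin (n + 2)), J ≠ Finset.univ → ∏ i ∈ J, β i ≤ 1 - ∑ i ∈ J, β i) ∧
      LinearIndependent ℝ b ∧ (∀ i, b i ∈ V) ∧
      (∀ x ∈ P, ∑ i : Fin (n + 1), β i.castSucc * (1 + b (Fin.castAdd e i) ⬝ᵥ x) ≤ 1) ∧
      ∀ x ∈ P, ∀ j : Fin e, 1 + b (Fin.natAdd (n + 1) j) ⬝ᵥ x ≤ 2 * sylvesterPred n := by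
  classical
  have hVP : ∀ v ∈ V, ∀ x ∈ P, 0 ≤ 1 + v ⬝ᵥ x := fun v hv x hx => by
    have h1 : v ∈ polarDual P := hV ▸ subset_convexHull ℝ _ hv
    have h2 : -1 ≤ v ⬝ᵥ x := h1 x hx
    linarith
  set G : Set ℕ := {n | ∃ (w : Fin (n + 2) → Fin d → ℝ) (β : Fin (n + 2) → ℝ),
    IsCircuit w β ∧ Antitone β ∧ ∀ i, w i ∈ V} with hG
  have hspanV := span_vertices_polarDual hP hV
  have hGne : G.Nonempty := by
    obtain ⟨v, hvV, hv⟩ : ∃ v ∈ V, v ≠ 0 := by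
      by_contra! hcon
      have : Submodule.span ℝ (V : Set (Fin d → ℝ)) = ⊥ := Submodule.span_eq_bot.2 hcon
      rw [hspanV] at this
      have hne : Nonempty (Fin d) := ⟨⟨0, hd⟩⟩
      exact top_ne_bot this
    obtain ⟨n, w, β, h1, h2, h3, -⟩ := exists_isCircuit_vertices_polarDual hP hV hvV hv
    exact ⟨n, w, β, h1, h2, h3⟩
  have hGbdd : BddAbove G := ⟨d, fun n hn => by
    obtain ⟨w, β, h1, -, -⟩ := hn
    have := h1.linearIndependent_castSucc.fintype_card_le_finrank
    simp at this
    omega⟩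
  obtain ⟨n, ⟨w, β, hw, hanti, hwV⟩, hmax⟩ : ∃ n ∈ G, ∀ n' ∈ G, n' ≤ n :=
    ⟨sSup G, Nat.sSup_mem hGne hGbdd, fun _ h => le_csSup hGbdd h⟩
  set t : Set (Fin d → ℝ) := {v | v ∈ V ∧ ∀ x ∈ P, 1 + v ⬝ᵥ x ≤ 2 * sylvesterPred n} with ht
  have hmem_t : ∀ (n' : ℕ) (w : Fin (n' + 2) → Fin d → ℝ) (β : Fin (n' + 2) → ℝ),
      IsCircuit w β → Antitone β → (∀ i, w i ∈ V) → ∀ i : Fin (n' + 1), w i.castSucc ∈ t := by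
    intro n' w β hw hanti hwV i
    refine ⟨hwV _, fun x hx => ?_⟩
    have h1 := inv_two_mul_sylvesterPred_le_castSucc β hw.pos hanti hw.sum_eq_one
      (hw.prod_le_of_vertices_polarDual hP h0 hV hVint hwV) i
    have h2 : β i.castSucc * (1 + w i.castSucc ⬝ᵥ x) ≤ 1 := by
      refine le_of_le_of_eq ?_ (hw.sum_mul_one_add_dotProduct x)
      exact Finset.single_le_sum (f := fun i => β i * (1 + w i ⬝ᵥ x))
        (fun i _ => mul_nonneg (hw.pos i).le (hVP _ (hwV i) x hx)) (Finset.mem_univ i.castSucc)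
    have h3 := sylvesterPred_mono (hmax n' ⟨w, β, hw, hanti, hwV⟩)
    have h4 := sylvesterPred_pos n'
    have h5 := hVP _ (hwV i.castSucc) x hx
    have h6 : (2 * sylvesterPred n')⁻¹ * (1 + w i.castSucc ⬝ᵥ x) ≤ 1 :=
      (mul_le_mul_of_nonneg_right h1 h5).trans h2
    rw [inv_mul_le_one₀ (by positivity)] at h6
    linarith
  have hspan_t : Submodule.span ℝ t = ⊤ := by
    rw [eq_top_iff, ← hspanV, Submodule.span_le]
    intro v hv
    by_cases hv0 : v = 0
    · rw [hv0]
      exact Submodule.zero_mem _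
    obtain ⟨n', w', β', h1, h2, h3, i, rfl⟩ := exists_isCircuit_vertices_polarDual hP hV hv hv0
    have h4 : ∀ i : Fin (n' + 1), w' i.castSucc ∈ Submodule.span ℝ t := fun i =>
      Submodule.subset_span (hmem_t n' w' β' h1 h2 h3 i)
    induction i using Fin.lastCases with
    | cast i => exact h4 i
    | last =>
      have h5 := h1.sum_smul
      rw [Fin.sum_univ_castSucc] at h5
      rw [SetLike.mem_coe, ← Submodule.smul_mem_iff _ (h1.pos (Fin.last (n' + 1))).ne',
        eq_neg_of_add_eq_zero_right h5]
      exact Submodule.neg_mem _ (Submodule.sum_mem _ fun i _ => Submodule.smul_mem _ _ (h4 i))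
  have hli := hw.linearIndependent_castSucc
  obtain ⟨B, hBt, hwB, htB, hB⟩ := exists_linearIndepOn_id_extension hli.linearIndepOn_id
    (Set.range_subset_iff.2 (hmem_t n w β hw hanti hwV))
  have hBfin : B.Finite := (V.finite_toSet).subset fun v hv => (hBt hv).1
  have hfin : Finite ↥(B \ Set.range fun i : Fin (n + 1) => w i.castSucc) :=
    (hBfin.subset Set.sdiff_subset).to_subtype
  obtain ⟨e, ⟨f⟩⟩ := Finite.exists_equiv_fin
    ↥(B \ Set.range fun i : Fin (n + 1) => w i.castSucc)
  set g : Fin (n + 1) ⊕ Fin e → B := Sum.elim (fun i => ⟨w i.castSucc, hwB ⟨i, rfl⟩⟩)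
    (fun j => ⟨f.symm j, (f.symm j).2.1⟩) with hg
  have hginj : Function.Injective g := by
    refine Function.Injective.sumElim (fun i j hij => hli.injective (Subtype.ext_iff.1 hij))
      (fun i j hij => f.symm.injective (Subtype.ext (by simpa using hij))) fun i j hij => ?_
    exact (f.symm j).2.2 ⟨i, Subtype.ext_iff.1 hij⟩
  have hgsurj : Function.Surjective g := by
    rintro ⟨v, hv⟩
    by_cases hvr : v ∈ Set.range fun i : Fin (n + 1) => w i.castSucc
    · obtain ⟨i, hi⟩ := hvr
      exact ⟨Sum.inl i, Subtype.ext hi⟩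
    · exact ⟨Sum.inr (f ⟨v, hv, hvr⟩), Subtype.ext (by simp [hg])⟩
  set b : Fin (n + 1 + e) → Fin d → ℝ := fun i => g (finSumFinEquiv.symm i) with hb
  have hbli : LinearIndependent ℝ b :=
    LinearIndependent.comp hB (g ∘ finSumFinEquiv.symm)
      (hginj.comp finSumFinEquiv.symm.injective)
  have hbspan : Submodule.span ℝ (Set.range b) = ⊤ := by
    have : Set.range b = B := by
      change Set.range (Subtype.val ∘ (g ∘ finSumFinEquiv.symm)) = B
      rw [Set.range_comp, (hgsurj.comp finSumFinEquiv.symm.surjective).range_eq]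
      simp
    rw [this, eq_top_iff, ← hspan_t, Submodule.span_le]
    exact htB
  have hb1 : ∀ i : Fin (n + 1), b (Fin.castAdd e i) = w i.castSucc := fun i => by simp [hb, hg]
  refine ⟨n, e, β, b, ?_, hw.pos, hanti, hw.sum_eq_one,
    hw.prod_le_of_vertices_polarDual hP h0 hV hVint hwV, hbli, fun i => (hBt (Subtype.prop _)).1,
    fun x hx => ?_, fun x hx j => (hBt (Subtype.prop _)).2 x hx⟩
  · simpa using (Module.finrank_eq_card_basis (Module.Basis.mk hbli hbspan.ge)).symm
  · have h1 := hw.sum_mul_one_add_dotProduct x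
    rw [Fin.sum_univ_castSucc] at h1
    simp only [hb1]
    have h2 := mul_nonneg (hw.pos (Fin.last (n + 1))).le (hVP _ (hwV (Fin.last (n + 1))) x hx)
    linarith

theorem volume_image_mulVec_add {d : ℕ} (M : Matrix (Fin d) (Fin d) ℝ) (c : Fin d → ℝ)
    (s : Set (Fin d → ℝ)) :
    volume ((fun x => M.mulVec x + c) '' s) = ENNReal.ofReal |M.det| * volume s := by
  have : (fun x => M.mulVec x + c) '' s = (fun x => x + c) '' (Matrix.toLin' M '' s) := by
    rw [Set.image_image]
    rfl
  rw [this, Set.image_add_right, measure_preimage_add_right, Measure.addHaar_image_linearMap,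
    LinearMap.det_toLin']

theorem eq_of_isClosed_of_convex_of_volume_le {d : ℕ} {K R : Set (Fin d → ℝ)} (hK : IsClosed K)
    (hR : IsClosed R) (hRc : Convex ℝ R) (hKR : K ⊆ R) (hpos : volume R ≠ 0)
    (hfin : volume K ≠ ∞) (hle : volume R ≤ volume K) : K = R := by
  have hlat : (interior R).Nonempty := by
    by_contra hcon
    rw [Set.not_nonempty_iff_eq_empty] at hcon
    apply hpos
    rw [← hRc.addHaar_frontier volume, hR.frontier_eq, hcon, Set.sdiff_empty]
  have hdiff : volume (R \ K) = 0 := by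
    rw [measure_sdiff hKR hK.measurableSet.nullMeasurableSet hfin]
    exact tsub_eq_zero_of_le hle
  refine hKR.antisymm fun x hx => ?_
  by_contra hxK
  have hcl : x ∈ closure (interior R) := by
    rw [hRc.closure_interior_eq_closure_of_nonempty_interior hlat]
    exact subset_closure hx
  have hne := mem_closure_iff.1 hcl Kᶜ hK.isOpen_compl hxK
  have hopen : IsOpen (Kᶜ ∩ interior R) := hK.isOpen_compl.inter isOpen_interior
  refine (hopen.measure_pos volume hne).ne' (measure_mono_null ?_ hdiff)
  exact fun y hy => ⟨interior_subset hy.2, hy.1⟩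

theorem convexHull_insert_zero_single {k : ℕ} (c : Fin k → ℝ) (hc : ∀ i, 0 < c i) :
    convexHull ℝ ({0} ∪ {x : Fin k → ℝ | ∃ j, x = c j • (Pi.single j (1 : ℝ) : Fin k → ℝ)})
      = cornerSimplex (fun i => (c i)⁻¹) 1 := by
  refine (convexHull_min ?_ (convex_cornerSimplex _ _)).antisymm fun z hz => ?_
  · rintro x (rfl | ⟨j, rfl⟩)
    · simp [cornerSimplex]
    · refine ⟨fun i => ?_, ?_⟩
      · simp only [Pi.smul_apply, Pi.single_apply, smul_eq_mul]
        have := (hc j).le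
        split_ifs <;> simp [this]
      · simp only [Pi.smul_apply, Pi.single_apply, smul_eq_mul]
        simp [(hc j).ne']
  · have h := (convex_convexHull ℝ ({0} ∪ {x : Fin k → ℝ | ∃ j, x = c j •
      (Pi.single j (1 : ℝ) : Fin k → ℝ)})).sum_mem (t := (Finset.univ : Finset (Option (Fin k))))
      (w := fun o => o.elim (1 - ∑ i, (c i)⁻¹ * z i) fun i => (c i)⁻¹ * z i)
      (z := fun o => o.elim 0 fun i => c i • (Pi.single i (1 : ℝ) : Fin k → ℝ))
      (by
        rintro (_ | i) -
        · exact sub_nonneg.2 hz.2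
        · exact mul_nonneg (inv_nonneg.2 (hc i).le) (hz.1 i))
      (by simp [Fintype.sum_option])
      (by
        rintro (_ | i) -
        · exact subset_convexHull ℝ _ (Or.inl rfl)
        · exact subset_convexHull ℝ _ (Or.inr ⟨i, rfl⟩))
    convert h using 1
    ext j
    simp only [Fintype.sum_option, Option.elim_none, Option.elim_some,
      Finset.sum_apply, Pi.smul_apply, smul_eq_mul, Pi.single_apply]
    simp [mul_right_comm, (hc j).ne']

theorem Ssimplex_eq_cornerSimplex (N : ℕ) :
    Ssimplex (N + 1) = cornerSimplex (fun i : Fin (N + 1) => sylvesterWeight N N i) 1 := by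
  have h := convexHull_insert_zero_single (fun j : Fin (N + 1) => (sylvesterWeight N N j)⁻¹)
    fun j => inv_pos.2 (sylvesterWeight_pos le_rfl _)
  simp only [inv_inv] at h
  rw [← h, Ssimplex]
  congr! 8 with x j
  have hj := j.2
  rw [sylvesterWeight, sylvesterPred, sylvesterPred, Nat.add_sub_cancel]
  split_ifs with h1 h2 h2
  · omega
  · rw [inv_inv]
    ring
  · simp
  · omega

theorem volume_Ssimplex {N : ℕ} :
    volume (Ssimplex (N + 1))
      = ENNReal.ofReal (2 * sylvesterPred N ^ 2 / (N + 1).factorial) := by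
  rw [Ssimplex_eq_cornerSimplex,
    volume_cornerSimplex _ (fun i => sylvesterWeight_pos le_rfl _) zero_le_one,
    ← Finset.prod_range (fun i => sylvesterWeight N N i), prod_sylvesterWeight le_rfl]
  congr 1
  have := sylvesterPred_pos N
  rw [show N + 1 - N = 1 by omega]
  field_simp
  ring

theorem volume_Rsimplex {N : ℕ} :
    volume (Rsimplex (N + 1))
      = ENNReal.ofReal (2 * sylvesterPred N ^ 2 / (N + 1).factorial) := by
  rw [← volume_Ssimplex, Rsimplex]
  simp only [sub_eq_add_neg]
  rw [Set.image_add_right, measure_preimage_add_right]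

theorem UnimodularEquiv.volume_eq {d : ℕ} {P Q : Set (Fin d → ℝ)} (h : UnimodularEquiv P Q) :
    volume Q = volume P := by
  obtain ⟨A, b, hA, rfl⟩ := h
  have hdet : (A.map fun z : ℤ => (z : ℝ)).det = ((A.det : ℤ) : ℝ) :=
    (RingHom.map_det (Int.castRingHom ℝ) A).symm
  rw [volume_image_mulVec_add, hdet]
  rcases Int.isUnit_iff.1 hA with h1 | h1 <;> simp [h1]

theorem IsLatticePolytope.isCompact {d : ℕ} {P : Set (Fin d → ℝ)} (hP : IsLatticePolytope P) :
    IsCompact P := by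
  obtain ⟨U, -, rfl⟩ := hP
  exact U.finite_toSet.isCompact_convexHull (𝕜 := ℝ)

theorem exists_int_matrix_of_linearIndependent {d : ℕ} (b : Fin d → Fin d → ℝ)
    (hb : LinearIndependent ℝ b) (hlat : ∀ i, IsLatticePt (b i)) :
    ∃ A : Matrix (Fin d) (Fin d) ℤ, (∀ i j, b i j = A i j) ∧ A.det ≠ 0 := by
  choose A hA using hlat
  refine ⟨A, hA, fun h0 => ?_⟩
  have hbA : Matrix.of b = Matrix.map A fun z : ℤ => (z : ℝ) := by
    ext i j
    exact hA i j
  have h1 : IsUnit (Matrix.of b).det :=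
    (Matrix.isUnit_iff_isUnit_det _).1 (Matrix.linearIndependent_rows_iff_isUnit.1 hb)
  have h2 : (Matrix.map A fun z : ℤ => (z : ℝ)).det = ((Matrix.det A : ℤ) : ℝ) :=
    (RingHom.map_det (Int.castRingHom ℝ) A).symm
  rw [hbA, h2, h0] at h1
  simp at h1

theorem IsReflexive.volume_le_and_unimodularEquiv {d : ℕ} (hd : 4 ≤ d)
    {P : Set (Fin d → ℝ)} (hP : IsReflexive P) :
    volume P ≤ ENNReal.ofReal (2 * sylvesterPred (d - 1) ^ 2 / d.factorial) ∧
      (volume P = ENNReal.ofReal (2 * sylvesterPred (d - 1) ^ 2 / d.factorial) →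
        UnimodularEquiv P (Rsimplex d)) := by
  obtain ⟨hPl, h0, V, hVint, hV⟩ := hP
  obtain ⟨n, e, β, b, rfl, hpos, hanti, hsum, hps, hli, hbV, hsimplex, hbox⟩ :=
    exists_basis_vertices_polarDual (by omega) hPl h0 hV hVint
  obtain ⟨A, hA, hdet⟩ := exists_int_matrix_of_linearIndependent b hli fun i => hVint _ (hbV i)
  set M : Matrix (Fin (n + 1 + e)) (Fin (n + 1 + e)) ℝ := A.map fun z : ℤ => (z : ℝ) with hM
  have hMdet : |M.det| = ((|A.det| : ℤ) : ℝ) := by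
    rw [Int.cast_abs]
    exact congrArg abs (RingHom.map_det (Int.castRingHom ℝ) A).symm
  have hMdet1 : 1 ≤ |M.det| := by
    rw [hMdet]
    exact_mod_cast Int.one_le_abs hdet
  set T : (Fin (n + 1 + e) → ℝ) → Fin (n + 1 + e) → ℝ := fun x => M.mulVec x + fun _ => 1 with hT
  have hTx : ∀ x i, T x i = 1 + b i ⬝ᵥ x := fun x i => by
    simp only [hT, hM, Pi.add_apply, Matrix.mulVec, dotProduct, hA, Matrix.map_apply]
    ring
  have hTnonneg : ∀ x ∈ P, ∀ i, 0 ≤ T x i := fun x hx i => by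
    have h1 : b i ∈ polarDual P := hV ▸ subset_convexHull ℝ _ (hbV i)
    have h2 : -1 ≤ b i ⬝ᵥ x := h1 x hx
    rw [hTx]
    linarith
  have hvolK : volume (T '' P) = ENNReal.ofReal |M.det| * volume P := volume_image_mulVec_add M _ P
  have hPK : volume P ≤ volume (T '' P) := by
    rw [hvolK]
    exact le_mul_of_one_le_left zero_le (by simpa using hMdet1)
  have ha := sylvesterPred_pos n
  have hw := weightBound_pos n
  have hβprod := inv_weightBound_le_prod_castSucc β hpos hanti hsum hps
  have hβpos : 0 < ∏ i : Fin (n + 1), β i.castSucc := Finset.prod_pos fun i _ => hpos _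
  have hfac : (0 : ℝ) < (n + 1).factorial := by positivity
  have hvolC := volume_cornerSimplex (fun i : Fin (n + 1) => β i.castSucc) (fun i => hpos _)
    zero_le_one
  rw [one_pow] at hvolC
  have hCle : 1 / ((n + 1).factorial * ∏ i : Fin (n + 1), β i.castSucc)
      ≤ weightBound n / (n + 1).factorial := by
    rw [inv_le_iff_one_le_mul₀ hw] at hβprod
    rw [div_le_div_iff₀ (by positivity) hfac]
    nlinarith
  rcases Nat.eq_zero_or_pos e with rfl | he
  · have hwb := weightBound_of_two_le (show 2 ≤ n by omega)
    have hKC : T '' P ⊆ cornerSimplex (fun i : Fin (n + 1) => β i.castSucc) 1 := by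
      rintro _ ⟨x, hx, rfl⟩
      refine ⟨hTnonneg x hx, ?_⟩
      simpa [hTx] using hsimplex x hx
    rw [show n + 1 + 0 - 1 = n from rfl,
      show (n + 1 + 0).factorial = (n + 1).factorial from rfl, ← hwb]
    have hCle' : volume (cornerSimplex (fun i : Fin (n + 1) => β i.castSucc) 1)
        ≤ ENNReal.ofReal (weightBound n / (n + 1).factorial) := by
      rw [hvolC]
      exact ENNReal.ofReal_le_ofReal hCle
    refine ⟨hPK.trans ((measure_mono hKC).trans hCle'), fun heq => ?_⟩
    have hτ : 0 < weightBound n / (n + 1).factorial := by positivity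
    have hKle := (measure_mono (μ := volume) hKC).trans hCle'
    have hA1 : |A.det| ≤ 1 := by
      rw [hvolK, heq, ← ENNReal.ofReal_mul (abs_nonneg _), ENNReal.ofReal_le_ofReal_iff hτ.le,
        hMdet] at hKle
      have : ((|A.det| : ℤ) : ℝ) ≤ 1 := le_of_mul_le_mul_right (by linarith) hτ
      exact_mod_cast this
    have hprod : ∏ i : Fin (n + 1), β i.castSucc = (weightBound n)⁻¹ := by
      refine le_antisymm ?_ hβprod
      have h1 := hPK.trans (measure_mono hKC)
      rw [heq, hvolC, ENNReal.ofReal_le_ofReal_iff (by positivity),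
        div_le_div_iff₀ hfac (by positivity)] at h1
      rw [← one_div, le_div_iff₀ hw]
      nlinarith
    have hweights := eq_sylvesterWeight_of_prod_castSucc_eq (by omega) β hpos hanti hsum hps hprod
    have hCS : cornerSimplex (fun i : Fin (n + 1) => β i.castSucc) 1 = Ssimplex (n + 1) := by
      rw [Ssimplex_eq_cornerSimplex]
      congr 1
      exact funext hweights
    have hKeq : T '' P = Ssimplex (n + 1) := by
      rw [← hCS]
      have hTc : Continuous T := by
        simp only [hT]
        fun_prop
      refine eq_of_isClosed_of_convex_of_volume_le (hPl.isCompact.image hTc).isClosed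
        (isClosed_cornerSimplex _ _) (convex_cornerSimplex _ _) hKC ?_
        (hKle.trans_lt ENNReal.ofReal_lt_top).ne (hCle'.trans (heq ▸ hPK))
      rw [hvolC]
      simp only [ne_eq, ENNReal.ofReal_eq_zero, not_le]
      positivity
    refine ⟨A, 0, Int.isUnit_iff_abs_eq.2 (le_antisymm hA1 (Int.one_le_abs hdet)), ?_⟩
    change (fun x : Fin (n + 1) → ℝ => x - fun _ => 1) '' Ssimplex (n + 1) = _
    rw [← hKeq, Set.image_image]
    refine Set.image_congr fun x _ => ?_
    ext i
    simp [hT, hM]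
  · have hlt : volume P < ENNReal.ofReal
        (2 * sylvesterPred (n + 1 + e - 1) ^ 2 / (n + 1 + e).factorial) := by
      have hKR : T '' P ⊆ {z : Fin (n + 1 + e) → ℝ | (fun i => z (Fin.castAdd e i)) ∈
          cornerSimplex (fun i : Fin (n + 1) => β i.castSucc) 1 ∧
          (fun j => z (Fin.natAdd (n + 1) j)) ∈
            Set.univ.pi fun _ : Fin e => Set.Icc 0 (2 * sylvesterPred n)} := by
        rintro _ ⟨x, hx, rfl⟩
        refine ⟨⟨fun i => hTnonneg x hx _, ?_⟩, fun j _ => ⟨hTnonneg x hx _, ?_⟩⟩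
        · simpa [hTx] using hsimplex x hx
        · simpa [hTx] using hbox x hx j
      refine hPK.trans_lt ((measure_mono hKR).trans_lt ?_)
      rw [volume_setOf_castAdd_natAdd, hvolC, volume_pi_pi]
      simp only [Real.volume_Icc, sub_zero, Finset.prod_const, Finset.card_univ, Fintype.card_fin]
      rw [← ENNReal.ofReal_pow (by positivity), ← ENNReal.ofReal_mul (by positivity)]
      have hstrict := weightBound_mul_pow_lt (N := n + e) (n := n) (by omega) (by omega)
      rw [show n + e - n = e by omega] at hstrict
      rw [show n + 1 + e = n + e + 1 by omega, Nat.add_sub_cancel]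
      refine (ENNReal.ofReal_lt_ofReal_iff (lt_trans (by positivity) hstrict)).2
        (lt_of_le_of_lt ?_ hstrict)
      exact mul_le_mul_of_nonneg_right hCle (by positivity)
    exact ⟨hlt.le, fun heq => absurd heq hlt.ne⟩

/-- For `d ≥ 4` and a reflexive polytope `P ⊂ ℝ^d`,
`vol(P) ≤ 2(s_d - 1)^2 / d!`, with equality iff `P` is unimodularly equivalent to `R_(d)`. -/
theorem reflexive_volume_le (d : ℕ) (hd : 4 ≤ d) (P : Set (Fin d → ℝ)) (hP : IsReflexive P) :
    volume P ≤ ENNReal.ofReal (2 * ((sylvester (d - 1) : ℝ) - 1) ^ 2 / (d.factorial : ℝ)) ∧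
      (volume P = ENNReal.ofReal (2 * ((sylvester (d - 1) : ℝ) - 1) ^ 2 / (d.factorial : ℝ)) ↔
        UnimodularEquiv P (Rsimplex d)) := by
  obtain ⟨h1, h2⟩ := hP.volume_le_and_unimodularEquiv hd
  refine ⟨h1, h2, fun h => ?_⟩
  obtain ⟨N, rfl⟩ : ∃ N, d = N + 1 := ⟨d - 1, by omega⟩
  rw [← h.volume_eq, volume_Rsimplex]
  rfl
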